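/- arXiv:math-ph/0402025 — 2 statements merged into one kernel-verified Lean document; each statement's English description precedes it below -/
import Mathlib

section
/- Kink numbers are homotopy invariants: if n̂, n̂' ∈ C⁰(P̂) are homotopic in C⁰(P̂), then k^{ac}(n̂) = k^{ac}(n̂') for every cleaved edge B̂^{ac}. (The kink number is an integer depending continuously on n̂ along any homotopy, hence is constant along it.) -/
open Matrix Set MeasureTheory
open scoped Classical

noncomputable section

/-- Points of `ℝ³`. -/
abbrev V3 := Fin 3 → ℝ

/-- The unit sphere `S² ⊂ ℝ³`. -/
def sphereS : Set V3 := {x | x ⬝ᵥ x = 1}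

/-- Rodrigues rotation of `v` by angle `θ` about the unit axis `F`. -/
def rot3 (F : V3) (θ : ℝ) (v : V3) : V3 :=
  Real.cos θ • v + Real.sin θ • (crossProduct F v) + ((1 - Real.cos θ) * (F ⬝ᵥ v)) • F

/-- The point at fraction `ρ` of arclength along the shortest geodesic on the
unit sphere from `p` to `a` (for `a ≠ -p`). -/
def geo (p a : V3) (ρ : ℝ) : V3 :=
  if p = a then p
  else (Real.sin ((1 - ρ) * Real.arccos (p ⬝ᵥ a)) / Real.sin (Real.arccos (p ⬝ᵥ a))) • p +
       (Real.sin (ρ * Real.arccos (p ⬝ᵥ a)) / Real.sin (Real.arccos (p ⬝ᵥ a))) • a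

/-- `ξ` is the continuous angle lift of the tangent field `n` along the path `z`
(defined on `[0,1]`), `η ∈ (-π,π)` the smallest-magnitude angle between the endpoint
values, and `κ` the resulting kink number: `2πκ = ξ(1) - η`. -/
def IsKinkAlong (Fn : V3) (n : V3 → V3) (z : ℝ → V3) (κ : ℤ) : Prop :=
  ∃ ξ : ℝ → ℝ, ContinuousOn ξ (Set.Icc 0 1) ∧ ξ 0 = 0 ∧
    (∀ t ∈ Set.Icc (0:ℝ) 1, n (z t) = rot3 Fn (ξ t) (n (z 0))) ∧
    ∃ η : ℝ, η ∈ Set.Ioo (-Real.pi) Real.pi ∧ n (z 1) = rot3 Fn η (n (z 0)) ∧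
      2 * Real.pi * (κ : ℝ) = ξ 1 - η

/-- `z` is a `2π`-periodic parameterization of a loop around the centre `ctr`, lying in the
plane through `ctr` with normal `N`, positively oriented with respect to `N` (the angle
`θ` increases by `2π` over a period). -/
def PosLoopParam (N ctr : V3) (z : ℝ → V3) : Prop :=
  Continuous z ∧ (∀ φ, z (φ + 2 * Real.pi) = z φ) ∧
  ∃ e₁ e₂ : V3, e₁ ⬝ᵥ e₁ = 1 ∧ e₂ ⬝ᵥ e₂ = 1 ∧ e₁ ⬝ᵥ e₂ = 0 ∧ crossProduct e₁ e₂ = N ∧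
    ∃ θ r : ℝ → ℝ, Continuous θ ∧ Monotone θ ∧ (∀ φ, θ (φ + 2 * Real.pi) = θ φ + 2 * Real.pi) ∧
      (∀ φ, 0 < r φ) ∧
      ∀ φ, z φ = ctr + r φ • (Real.cos (θ φ) • e₁ + Real.sin (θ φ) • e₂)

/-- The map `S² → S²` obtained by gluing, along the equator, the map
`ν(ρ,φ) = n(ρ z(φ) + (1-ρ) ctr)` (on the upper hemisphere) with the map
`ν₀(ρ,φ) = g_ρ(-s, n(z(φ)))` (on the lower hemisphere), where `(ρ,φ)` are the polar
coordinates of the first two coordinates. -/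
def wrapMap (n : V3 → V3) (z : ℝ → V3) (ctr s : V3) : V3 → V3 := fun x =>
  if 0 ≤ x 2 then
    n ((Real.sqrt ((x 0) ^ 2 + (x 1) ^ 2)) • z (Complex.arg ((x 0 : ℂ) + (x 1 : ℂ) * Complex.I))
      + (1 - Real.sqrt ((x 0) ^ 2 + (x 1) ^ 2)) • ctr)
  else
    geo (-s) (n (z (Complex.arg ((x 0 : ℂ) + (x 1 : ℂ) * Complex.I))))
      (Real.sqrt ((x 0) ^ 2 + (x 1) ^ 2))

/-- Homotopy of maps of the unit sphere `S²` to itself. -/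
def SphHomotopic (f g : V3 → V3) : Prop :=
  ∃ H : ℝ → V3 → V3,
    ContinuousOn (fun q : ℝ × V3 => H q.1 q.2) (Set.Icc (0:ℝ) 1 ×ˢ sphereS) ∧
    (∀ t ∈ Set.Icc (0:ℝ) 1, Set.MapsTo (H t) sphereS sphereS) ∧
    (∀ x ∈ sphereS, H 0 x = f x) ∧ (∀ x ∈ sphereS, H 1 x = g x)

/-- The standard degree-`k` self-map of `S²`: in cylindrical coordinates it multiplies
the azimuthal angle by `k`, fixing the vertical coordinate. -/
def powMap (k : ℤ) : V3 → V3 := fun x =>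
  if ((x 0 : ℂ) + (x 1 : ℂ) * Complex.I) = 0 then x
  else
    ![‖(x 0 : ℂ) + (x 1 : ℂ) * Complex.I‖ *
        ((((x 0 : ℂ) + (x 1 : ℂ) * Complex.I) /
          (‖(x 0 : ℂ) + (x 1 : ℂ) * Complex.I‖ : ℂ)) ^ k).re,
      ‖(x 0 : ℂ) + (x 1 : ℂ) * Complex.I‖ *
        ((((x 0 : ℂ) + (x 1 : ℂ) * Complex.I) /
          (‖(x 0 : ℂ) + (x 1 : ℂ) * Complex.I‖ : ℂ)) ^ k).im,
      x 2]

/-- `deg` is a Brouwer degree for self-maps of `S²`: it is invariant under homotopy of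
continuous self-maps of the sphere, and assigns degree `k` to the standard map `powMap k`.
(These axioms determine `deg` uniquely on continuous self-maps of `S²`, by Hopf's theorem.) -/
def DegreeTheory (deg : (V3 → V3) → ℤ) : Prop :=
  (∀ f g : V3 → V3, ContinuousOn f sphereS → Set.MapsTo f sphereS sphereS →
      ContinuousOn g sphereS → Set.MapsTo g sphereS sphereS →
      SphHomotopic f g → deg f = deg g) ∧
  (∀ k : ℤ, deg (powMap k) = k)

/-- The pullback under `u : ℝ² → S²` of the (normalized) area 2-form of `S²`,
evaluated on the standard basis of `ℝ²`: `u ⋅ (∂₁ u × ∂₂ u)`. -/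
def pullA (u : ℝ × ℝ → V3) (p : ℝ × ℝ) : ℝ :=
  u p ⬝ᵥ crossProduct (fderiv ℝ u p (1, 0)) (fderiv ℝ u p (0, 1))

/-- The integral `∫_A n*ω` of the pullback under `n` of the area form `ω` of `S²`, over a
planar region `A` lying in the plane through `o` spanned by the orthonormal pair `e₁, e₂`
(the pair orienting the plane). -/
def faceInt (n : V3 → V3) (o e₁ e₂ : V3) (A : Set V3) : ℝ :=
  ∫ p : ℝ × ℝ in {q : ℝ × ℝ | o + q.1 • e₁ + q.2 • e₂ ∈ A},
    pullA (fun q : ℝ × ℝ => n (o + q.1 • e₁ + q.2 • e₂)) p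

/-- The 1-form `γ = (1 - cos α) dβ` on `S² - {s}` (where `(α,β)` are spherical polar
coordinates with south pole at `s`, and `e₁, e₂` is an orthonormal azimuthal frame with
`e₁ ×₃ e₂ = -s`), evaluated at the point `v` on the tangent vector `w`. -/
def gammaForm (s e₁ e₂ : V3) (v w : V3) : ℝ :=
  if (v ⬝ᵥ e₁) ^ 2 + (v ⬝ᵥ e₂) ^ 2 = 0 then 0
  else (1 + v ⬝ᵥ s) *
    (((v ⬝ᵥ e₁) * (w ⬝ᵥ e₂) - (v ⬝ᵥ e₂) * (w ⬝ᵥ e₁)) / ((v ⬝ᵥ e₁) ^ 2 + (v ⬝ᵥ e₂) ^ 2))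

/-- The closed spherical geodesic triangle with vertices `a`, `b`, `c` (pairwise
non-antipodal): the radial projection to the sphere of the planar triangle with these
vertices. Its sides are the shortest geodesic arcs joining consecutive vertices. -/
def sphTri (a b c : V3) : Set V3 :=
  {x | ∃ α β γ : ℝ, 0 ≤ α ∧ 0 ≤ β ∧ 0 ≤ γ ∧ α • a + β • b + γ • c ≠ 0 ∧
    x = (Real.sqrt ((α • a + β • b + γ • c) ⬝ᵥ (α • a + β • b + γ • c)))⁻¹ •
      (α • a + β • b + γ • c)}

/-- The shortest geodesic arc on the sphere from `a` to `b` (for `a ≠ -b`). -/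
def sphArc (a b : V3) : Set V3 :=
  {x | ∃ α β : ℝ, 0 ≤ α ∧ 0 ≤ β ∧ α • a + β • b ≠ 0 ∧
    x = (Real.sqrt ((α • a + β • b) ⬝ᵥ (α • a + β • b)))⁻¹ • (α • a + β • b)}

/-- The oriented area `A(a,b,c)` of the spherical geodesic triangle with vertices
`a`, `b`, `c`: `A = 2 arg((1 + a⋅b + b⋅c + c⋅a) + i (a×b)⋅c)`, with `arg ∈ (-π, π]`. -/
def sphA (a b c : V3) : ℝ :=
  2 * Complex.arg (((1 + a ⬝ᵥ b + b ⬝ᵥ c + c ⬝ᵥ a : ℝ) : ℂ) +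
    ((crossProduct a b ⬝ᵥ c : ℝ) : ℂ) * Complex.I)

/-- `σ(a,b,c)` relative to the point `s`: equal to `sgn((a×b)⋅s)` if `s` lies in the
spherical triangle with vertices `a`, `b`, `c`, and `0` otherwise. -/
def sphSigma (s a b c : V3) : ℝ :=
  if s ∈ sphTri a b c then Real.sign (crossProduct a b ⬝ᵥ s) else 0

/-- A compact convex polyhedron `P̄ ⊂ ℝ³` with nonempty interior: its vertices `vert`,
faces `face` (with outward unit normals `Fnormal` and supporting planes
`{x | x ⋅ Fnormal c = foffset c}`), edges `edge` (segments between vertices), together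
with the truncation data: for each vertex `a` a plane through `cpt a` with outward unit
normal `Cnormal a` separating `vert a` from the other vertices, the planes being pairwise
disjoint within `P̄`.  The combinatorial data records, for each face `c`, its `m c`
vertices `fvert c 0, fvert c 1, …` and edges `fedge c i` (from `fvert c i` to
`fvert c (i+1)`) in cyclic order, positively oriented with respect to the outward normal;
and, for each vertex `a`, its `vm a` incident edges `vedge a i` and faces `vface a i`
(with `vface a i` containing the consecutive edges `vedge a i` and `vedge a (i+1)`) in
cyclic order, positively oriented with respect to the outward normal of the cleaved face. -/
structure PolyCtx where
  nv : ℕ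
  ne : ℕ
  nf : ℕ
  Pbar : Set V3
  vert : Fin nv → V3
  face : Fin nf → Set V3
  Fnormal : Fin nf → V3
  foffset : Fin nf → ℝ
  edge : Fin ne → Set V3
  esrc : Fin ne → Fin nv
  etgt : Fin ne → Fin nv
  edgeDir : Fin ne → V3
  cpt : Fin nv → V3
  Cnormal : Fin nv → V3
  m : Fin nf → ℕ
  fvert : Fin nf → ℕ → Fin nv
  fedge : Fin nf → ℕ → Fin ne
  vm : Fin nv → ℕ
  vedge : Fin nv → ℕ → Fin ne
  vface : Fin nv → ℕ → Fin nf
  compact : IsCompact Pbar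
  convex : Convex ℝ Pbar
  int_nonempty : (interior Pbar).Nonempty
  hull : Pbar = convexHull ℝ (Set.range vert)
  vert_extreme : ∀ a, vert a ∉ convexHull ℝ (Set.range vert \ {vert a})
  vert_inj : Function.Injective vert
  Fnormal_unit : ∀ c, Fnormal c ⬝ᵥ Fnormal c = 1
  face_def : ∀ c, face c = {x ∈ Pbar | x ⬝ᵥ Fnormal c = foffset c}
  face_supp : ∀ c, ∀ x ∈ Pbar, x ⬝ᵥ Fnormal c ≤ foffset c
  frontier_eq : frontier Pbar = ⋃ c, face c
  edge_def : ∀ b, edge b = segment ℝ (vert (esrc b)) (vert (etgt b))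
  edge_proper : ∀ b, esrc b ≠ etgt b
  edgeDir_unit : ∀ b, edgeDir b ⬝ᵥ edgeDir b = 1
  edgeDir_dir : ∀ b, ∃ lam : ℝ, 0 < lam ∧ vert (etgt b) - vert (esrc b) = lam • edgeDir b
  edge_two_faces : ∀ b, ∃ c c', edge b ⊆ face c ∧ edge b ⊆ face c' ∧
    crossProduct (Fnormal c) (Fnormal c') ≠ 0
  Cnormal_unit : ∀ a, Cnormal a ⬝ᵥ Cnormal a = 1
  sep_vert : ∀ a, 0 < (vert a - cpt a) ⬝ᵥ Cnormal a
  sep_other : ∀ a a', a' ≠ a → (vert a' - cpt a) ⬝ᵥ Cnormal a < 0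
  cleave_sub : ∀ a a' : Fin nv, ∀ x ∈ Pbar, (x - cpt a) ⬝ᵥ Cnormal a = 0 →
    (x - cpt a') ⬝ᵥ Cnormal a' ≤ 0
  m_ge : ∀ c, 3 ≤ m c
  fvert_per : ∀ c i, fvert c (i + m c) = fvert c i
  fedge_per : ∀ c i, fedge c (i + m c) = fedge c i
  fvert_inj : ∀ c, ∀ i j : ℕ, i < j → j < m c → fvert c i ≠ fvert c j
  fedge_seg : ∀ c i, edge (fedge c i) = segment ℝ (vert (fvert c i)) (vert (fvert c (i + 1)))
  fedge_sub : ∀ c i, edge (fedge c i) ⊆ face c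
  vm_ge : ∀ a, 3 ≤ vm a
  vedge_per : ∀ a i, vedge a (i + vm a) = vedge a i
  vface_per : ∀ a i, vface a (i + vm a) = vface a i
  vedge_inj : ∀ a, ∀ i j : ℕ, i < j → j < vm a → vedge a i ≠ vedge a j
  vedge_mem : ∀ a i, vert a ∈ edge (vedge a i)
  vface_between : ∀ a i, edge (vedge a i) ⊆ face (vface a i) ∧
    edge (vedge a (i + 1)) ⊆ face (vface a i)

namespace PolyCtx

variable (P : PolyCtx)

/-- `P`: the polyhedron `P̄` with its vertices removed. -/
def Pset : Set V3 := P.Pbar \ Set.range P.vert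

/-- The closed half-space `R^a` cut off by the cleaving plane at the vertex `a`. -/
def Rhalf (a : Fin P.nv) : Set V3 := {x | (x - P.cpt a) ⬝ᵥ P.Cnormal a ≤ 0}

/-- The intersection of all the half-spaces `R^a`. -/
def Rall : Set V3 := ⋂ a, P.Rhalf a

/-- The truncated polyhedron `P̂ = P ∩ ⋂ₐ R^a`. -/
def PhatSet : Set V3 := P.Pset ∩ P.Rall

/-- The cleaved face `Ĉ^a = C^a ∩ P`. -/
def Chat (a : Fin P.nv) : Set V3 := {x | (x - P.cpt a) ⬝ᵥ P.Cnormal a = 0} ∩ P.Pset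

/-- The truncated face `F̂^c = F^c ∩ ⋂ₐ R^a`. -/
def Fhat (c : Fin P.nf) : Set V3 := P.face c ∩ P.Rall

/-- The cleaved edge `B̂^{ac} = Ĉ^a ∩ F̂^c`. -/
def Bhat (a : Fin P.nv) (c : Fin P.nf) : Set V3 := P.Chat a ∩ P.Fhat c

/-- The truncated edge `Ê^b = E^b ∩ ⋂ₐ R^a`. -/
def Ehat (b : Fin P.ne) : Set V3 := P.edge b ∩ P.Rall

/-- The boundary `∂Ĉ^a` of the cleaved face: the union of its cleaved edges. -/
def bdChat (a : Fin P.nv) : Set V3 := ⋃ c, P.Bhat a c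

/-- The boundary `∂F̂^c` of the truncated face: its truncated edges and cleaved edges. -/
def bdFhat (c : Fin P.nf) : Set V3 :=
  (⋃ i ∈ Finset.range (P.m c), P.Ehat (P.fedge c i)) ∪
    ⋃ i ∈ Finset.range (P.m c), P.Bhat (P.fvert c i) c

/-- The boundary `∂P̂` of the truncated polyhedron: cleaved faces and truncated faces. -/
def bdPhat : Set V3 := (⋃ a, P.Chat a) ∪ ⋃ c, P.Fhat c

/-- `n ∈ C⁰(P)`: a continuous unit-vector field on `P`, tangent to each face. -/
def MemC0P (n : V3 → V3) : Prop :=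
  ContinuousOn n P.Pset ∧ (∀ x ∈ P.Pset, n x ∈ sphereS) ∧
  ∀ c, ∀ x ∈ P.face c ∩ P.Pset, n x ⬝ᵥ P.Fnormal c = 0

/-- `n ∈ C⁰(P̂)`: a continuous unit-vector field on `P̂`, tangent to each truncated
face `F̂^c` (but not necessarily to the cleaved faces). -/
def MemC0Phat (n : V3 → V3) : Prop :=
  ContinuousOn n P.PhatSet ∧ (∀ x ∈ P.PhatSet, n x ∈ sphereS) ∧
  ∀ c, ∀ x ∈ P.Fhat c, n x ⬝ᵥ P.Fnormal c = 0

/-- Homotopy in `C⁰(P)`. -/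
def HomotopicP (n n' : V3 → V3) : Prop :=
  ∃ H : ℝ → V3 → V3,
    ContinuousOn (fun q : ℝ × V3 => H q.1 q.2) (Set.Icc (0:ℝ) 1 ×ˢ P.Pset) ∧
    (∀ t ∈ Set.Icc (0:ℝ) 1, P.MemC0P (H t)) ∧
    (∀ x ∈ P.Pset, H 0 x = n x) ∧ (∀ x ∈ P.Pset, H 1 x = n' x)

/-- Homotopy in `C⁰(P̂)`. -/
def HomotopicPhat (n n' : V3 → V3) : Prop :=
  ∃ H : ℝ → V3 → V3,
    ContinuousOn (fun q : ℝ × V3 => H q.1 q.2) (Set.Icc (0:ℝ) 1 ×ˢ P.PhatSet) ∧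
    (∀ t ∈ Set.Icc (0:ℝ) 1, P.MemC0Phat (H t)) ∧
    (∀ x ∈ P.PhatSet, H 0 x = n x) ∧ (∀ x ∈ P.PhatSet, H 1 x = n' x)

/-- The edge orientation `e^b(n) = ε`: `n` has the constant value `ε` on `Ê^b`. -/
def IsEdgeOrient (b : Fin P.ne) (n : V3 → V3) (ε : V3) : Prop :=
  ∀ x ∈ P.Ehat b, n x = ε

/-- `z : [0,1] → ℝ³` is a continuous injective parameterization of the cleaved edge
`B̂^{ac}`, positively oriented with respect to the outward normal `F^c` (the face
`F̂^c` lies on the positive side of `F^c × (z 1 - z 0)`). -/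
def IsPosParamSeg (a : Fin P.nv) (c : Fin P.nf) (z : ℝ → V3) : Prop :=
  ContinuousOn z (Set.Icc 0 1) ∧ z '' Set.Icc 0 1 = P.Bhat a c ∧
  Set.InjOn z (Set.Icc 0 1) ∧
  ∀ x ∈ P.Fhat c, 0 ≤ (x - z 0) ⬝ᵥ crossProduct (P.Fnormal c) (z 1 - z 0)

/-- The kink number `k^{ac}(n) = κ`. -/
def HasKink (a : Fin P.nv) (c : Fin P.nf) (n : V3 → V3) (κ : ℤ) : Prop :=
  ∃ z : ℝ → V3, P.IsPosParamSeg a c z ∧ IsKinkAlong (P.Fnormal c) n z κ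

/-- `s ∈ S²` is admissible: not orthogonal to any face normal. -/
def AdmissibleS (s : V3) : Prop := s ∈ sphereS ∧ ∀ c, s ⬝ᵥ P.Fnormal c ≠ 0

/-- The wrapping number `w^a(n) = w`, computed (relative to a Brouwer degree `deg` and
an admissible reference point `s`) as the degree of the map `S² → S²` glued from the
restriction of `n` to the cleaved face `Ĉ^a` and the geodesic contraction of its boundary
values to `-s`, using an interior point `ctr` of `Ĉ^a` and a positively oriented
`2π`-periodic parameterization `z` of `∂Ĉ^a`. -/
def HasWrap (deg : (V3 → V3) → ℤ) (s : V3) (a : Fin P.nv) (n : V3 → V3) (w : ℤ) : Prop :=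
  ∃ ctr z, ctr ∈ P.Chat a ∧ ctr ∉ P.bdChat a ∧
    PosLoopParam (P.Cnormal a) ctr z ∧ Set.range z = P.bdChat a ∧
    deg (wrapMap n z ctr s) = w

/-- `n` and `n'` have the same invariants: equal edge orientations, kink numbers and
wrapping numbers. -/
def SameInv (deg : (V3 → V3) → ℤ) (s : V3) (n n' : V3 → V3) : Prop :=
  (∀ b : Fin P.ne, Set.EqOn n n' (P.Ehat b)) ∧
  (∀ a c, ∀ κ : ℤ, P.HasKink a c n κ ↔ P.HasKink a c n' κ) ∧
  (∀ a, ∀ w : ℤ, P.HasWrap deg s a n w ↔ P.HasWrap deg s a n' w)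

end PolyCtx


lemma dot_three (x y : V3) : x ⬝ᵥ y = x 0 * y 0 + x 1 * y 1 + x 2 * y 2 := by
  simp [dotProduct, Fin.sum_univ_three]

lemma v3_ext {x y : V3} (h0 : x 0 = y 0) (h1 : x 1 = y 1) (h2 : x 2 = y 2) : x = y := by
  ext i; fin_cases i <;> assumption

lemma dot_self_pos {x : V3} (hx : x ≠ 0) : 0 < x ⬝ᵥ x := by
  have h0 : 0 ≤ x ⬝ᵥ x := by rw [dot_three]; nlinarith [sq_nonneg (x 0), sq_nonneg (x 1), sq_nonneg (x 2)]
  rcases h0.lt_or_eq with h | h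
  · exact h
  · exact absurd (dotProduct_self_eq_zero.1 h.symm) hx

/-- Lagrange's identity. -/
lemma lagrange_three (x y : V3) :
    (x ⬝ᵥ y) ^ 2 = (x ⬝ᵥ x) * (y ⬝ᵥ y) - crossProduct x y ⬝ᵥ crossProduct x y := by
  simp only [dot_three, cross_apply]; simp; ring

/-- Two unit vectors orthogonal to two independent vectors agree up to sign. -/
lemma dot_sq_eq_one {F G x y : V3} (hFG : crossProduct F G ≠ 0)
    (hx : x ⬝ᵥ x = 1) (hy : y ⬝ᵥ y = 1) (hxF : x ⬝ᵥ F = 0) (hxG : x ⬝ᵥ G = 0)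
    (hyF : y ⬝ᵥ F = 0) (hyG : y ⬝ᵥ G = 0) : (x ⬝ᵥ y) ^ 2 = 1 := by
  set w := crossProduct F G with hw
  have key : ∀ v : V3, v ⬝ᵥ F = 0 → v ⬝ᵥ G = 0 → crossProduct v w = 0 := by
    intro v h1 h2
    have : crossProduct v w = (v ⬝ᵥ G) • F - (v ⬝ᵥ F) • G := by
      apply v3_ext <;> simp [hw, cross_apply, dot_three] <;> ring
    rw [this, h1, h2]; simp
  have hxw := key x hxF hxG
  have hyw := key y hyF hyG
  have h1 := lagrange_three x w
  have h2 := lagrange_three y w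
  have hwp := dot_self_pos hFG
  rw [hxw, hx] at h1
  rw [hyw, hy] at h2
  have h3 : (x ⬝ᵥ y) * (w ⬝ᵥ w) = (x ⬝ᵥ w) * (y ⬝ᵥ w) + crossProduct x w ⬝ᵥ crossProduct y w := by
    simp only [dot_three, cross_apply]; simp; ring
  rw [hxw] at h3
  simp at h1 h2 h3
  have h4 : ((x ⬝ᵥ y) ^ 2) * (w ⬝ᵥ w) ^ 2 = 1 * (w ⬝ᵥ w) ^ 2 := by
    rw [← mul_pow, h3, mul_pow, h1, h2]; ring
  exact mul_right_cancel₀ (by positivity) h4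

lemma eq_of_dot_eq_one {x y : V3} (hx : x ⬝ᵥ x = 1) (hy : y ⬝ᵥ y = 1) (h : x ⬝ᵥ y = 1) :
    x = y := by
  have : (x - y) ⬝ᵥ (x - y) = 0 := by
    have : (x - y) ⬝ᵥ (x - y) = x ⬝ᵥ x - 2 * (x ⬝ᵥ y) + y ⬝ᵥ y := by
      simp only [dot_three]; simp; ring
    rw [this, hx, hy, h]; norm_num
  exact sub_eq_zero.1 (dotProduct_self_eq_zero.1 this)

/-- Parallel unit vectors. -/
lemma eq_smul_of_cross_zero {F G : V3} (hF : F ⬝ᵥ F = 1) (h : crossProduct F G = 0) :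
    G = (F ⬝ᵥ G) • F := by
  have h1 : crossProduct F (crossProduct F G) = (F ⬝ᵥ G) • F - (F ⬝ᵥ F) • G := by
    apply v3_ext <;> simp [cross_apply, dot_three] <;> ring
  rw [h, hF, one_smul, map_zero] at h1
  exact (sub_eq_zero.1 h1.symm).symm

lemma frame_norm {F e h : V3} (hF : F ⬝ᵥ F = 1) (he : e ⬝ᵥ e = 1) (hFe : e ⬝ᵥ F = 0)
    (hh : h ⬝ᵥ h = 1) (hhF : h ⬝ᵥ F = 0) :
    (h ⬝ᵥ e) ^ 2 + (h ⬝ᵥ crossProduct F e) ^ 2 = 1 := by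
  have : (h ⬝ᵥ crossProduct F e) ^ 2 = (h ⬝ᵥ h) * ((F ⬝ᵥ F) * (e ⬝ᵥ e) - (e ⬝ᵥ F) ^ 2)
      - (h ⬝ᵥ F) * ((h ⬝ᵥ F) * (e ⬝ᵥ e) - (e ⬝ᵥ F) * (h ⬝ᵥ e))
      + (h ⬝ᵥ e) * ((h ⬝ᵥ F) * (e ⬝ᵥ F) - (F ⬝ᵥ F) * (h ⬝ᵥ e)) := by
    simp only [dot_three, cross_apply]; simp; ring
  rw [this, hF, he, hFe, hh, hhF]; ring

lemma rot3_dot {F e : V3} (hF : F ⬝ᵥ F = 1) (he : e ⬝ᵥ e = 1) (hFe : e ⬝ᵥ F = 0) (θ : ℝ) :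
    rot3 F θ e ⬝ᵥ e = Real.cos θ ∧ rot3 F θ e ⬝ᵥ crossProduct F e = Real.sin θ := by
  have hFe' : F ⬝ᵥ e = 0 := by rw [dotProduct_comm]; exact hFe
  have h2 : crossProduct F e ⬝ᵥ crossProduct F e = 1 := by
    have := lagrange_three F e
    rw [hF, he, hFe'] at this; linarith
  have h3 : crossProduct F e ⬝ᵥ e = 0 := by
    simp only [dot_three, cross_apply]; simp; ring
  have h4 : e ⬝ᵥ crossProduct F e = 0 := by rw [dotProduct_comm]; exact h3
  constructor <;> simp [rot3, add_dotProduct, smul_dotProduct, hFe', he, h2, h3, h4]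

open unitInterval in
/-- Homotopy invariance, relative to endpoints, of the total rotation angle. -/
lemma angle_homotopy {F e : V3} (hF : F ⬝ᵥ F = 1) (he : e ⬝ᵥ e = 1) (hFe : e ⬝ᵥ F = 0)
    (h : I × I → V3) (hc : Continuous h) (hu : ∀ q, h q ⬝ᵥ h q = 1) (ht : ∀ q, h q ⬝ᵥ F = 0)
    (h0 : ∀ t, h (0, t) = e) (e1 : V3) (h1 : ∀ t, h (1, t) = e1) (ξ ξ' : ℝ → ℝ)
    (hξ : ContinuousOn ξ (Set.Icc 0 1)) (hξ' : ContinuousOn ξ' (Set.Icc 0 1))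
    (hξ0 : ξ 0 = 0) (hξ'0 : ξ' 0 = 0)
    (hl : ∀ s : I, h (s, 0) = rot3 F (ξ s) e) (hl' : ∀ s : I, h (s, 1) = rot3 F (ξ' s) e) :
    ξ 1 = ξ' 1 := by
  have cov := Circle.isCoveringMap_exp
  let toC : I × I → ℂ := fun q => ⟨h q ⬝ᵥ e, h q ⬝ᵥ crossProduct F e⟩
  have hcC : Continuous toC := by
    have : toC = fun q => ((h q ⬝ᵥ e : ℝ) : ℂ) + ((h q ⬝ᵥ crossProduct F e : ℝ) : ℂ) * Complex.I := by
      funext q; apply Complex.ext <;> simp [toC]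
    rw [this]
    have hd : ∀ v : V3, Continuous fun q => h q ⬝ᵥ v := fun v => hc.dotProduct continuous_const
    exact (Complex.continuous_ofReal.comp (hd _)).add
      ((Complex.continuous_ofReal.comp (hd _)).mul continuous_const)
  have hn : ∀ q, toC q ∈ Submonoid.unitSphere ℂ := by
    intro q
    show toC q ∈ Metric.sphere (0 : ℂ) 1
    rw [mem_sphere_zero_iff_norm]
    have := frame_norm hF he hFe (hu q) (ht q)
    rw [Complex.norm_eq_sqrt_sq_add_sq]
    simp [toC, this]
  let K : C(I × I, Circle) := ⟨fun q => ⟨toC q, hn q⟩, hcC.subtype_mk hn⟩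
  have hK : ∀ q θ, h q = rot3 F θ e → K q = Circle.exp θ := by
    intro q θ hq
    obtain ⟨a, b⟩ := rot3_dot hF he hFe θ
    apply Circle.ext
    rw [Circle.coe_exp]
    show toC q = _
    apply Complex.ext
    · simp [toC, hq, a, Complex.exp_ofReal_mul_I_re]
    · simp [toC, hq, b, Complex.exp_ofReal_mul_I_im]
  have hr0 : e = rot3 F 0 e := by simp [rot3]
  let f0 : C(I, ℝ) := ContinuousMap.const I 0
  have H0 : ∀ t, K (0, t) = Circle.exp (f0 t) := fun t => hK _ _ (by rw [h0 t]; exact hr0)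
  let L := cov.liftHomotopy K f0 H0
  have hL : ∀ q, Circle.exp (L q) = K q := fun q => congr_fun (cov.liftHomotopy_lifts K f0 H0) q
  have hL0 : ∀ t, L (0, t) = 0 := cov.liftHomotopy_zero K f0 H0
  have hξc : Continuous fun s : I => ξ s := continuousOn_iff_continuous_domRestrict.1 hξ
  have hξc' : Continuous fun s : I => ξ' s := continuousOn_iff_continuous_domRestrict.1 hξ'
  have e0 : (fun s : I => L (s, 0)) = fun s : I => ξ s := by
    apply cov.eq_of_comp_eq (L.continuous.comp (by fun_prop)) hξc _ 0
    · simp [hL0, hξ0]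
    · funext s; simp [hL, hK _ _ (hl s)]
  have e1' : (fun s : I => L (s, 1)) = fun s : I => ξ' s := by
    apply cov.eq_of_comp_eq (L.continuous.comp (by fun_prop)) hξc' _ 0
    · simp [hL0, hξ'0]
    · funext s; simp [hL, hK _ _ (hl' s)]
  have e2 : (fun t : I => L (1, t)) = fun _ : I => L (1, 0) := by
    apply cov.eq_of_comp_eq (L.continuous.comp (by fun_prop)) continuous_const _ 0
    · rfl
    · funext s
      simp only [Function.comp, hL]
      apply Circle.ext
      show toC _ = toC _
      simp [toC, h1]
  have a1 := congr_fun e0 1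
  have a2 := congr_fun e1' 1
  have a3 := congr_fun e2 1
  simp at a1 a2 a3
  rw [← a1, ← a2, a3]

lemma eta_unique {F e : V3} (hF : F ⬝ᵥ F = 1) (he : e ⬝ᵥ e = 1) (hFe : e ⬝ᵥ F = 0) {η η' : ℝ}
    (h : η ∈ Set.Ioo (-Real.pi) Real.pi) (h' : η' ∈ Set.Ioo (-Real.pi) Real.pi)
    (hr : rot3 F η e = rot3 F η' e) : η = η' := by
  obtain ⟨a, b⟩ := rot3_dot hF he hFe η
  obtain ⟨a', b'⟩ := rot3_dot hF he hFe η'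
  apply Circle.exp_injOn_Ioc (a := -Real.pi) (b := Real.pi) (by linarith)
    (Set.Ioo_subset_Ioc_self h) (Set.Ioo_subset_Ioc_self h')
  apply Circle.ext
  rw [Circle.coe_exp, Circle.coe_exp]
  apply Complex.ext
  · rw [Complex.exp_ofReal_mul_I_re, Complex.exp_ofReal_mul_I_re, ← a, ← a', hr]
  · rw [Complex.exp_ofReal_mul_I_im, Complex.exp_ofReal_mul_I_im, ← b, ← b', hr]

namespace PolyCtx

lemma interior_lt (P : PolyCtx) {y : V3} (hy : y ∈ interior P.Pbar) (c : Fin P.nf) :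
    y ⬝ᵥ P.Fnormal c < P.foffset c := by
  have hc : Continuous fun ε : ℝ => y + ε • P.Fnormal c := by fun_prop
  have h1 : ∀ᶠ ε in nhds (0 : ℝ), y + ε • P.Fnormal c ∈ interior P.Pbar :=
    hc.continuousAt.eventually_mem (by simpa using isOpen_interior.mem_nhds hy)
  have h2 : ∀ᶠ ε in nhdsWithin (0 : ℝ) (Set.Ioi 0), y + ε • P.Fnormal c ∈ interior P.Pbar :=
    h1.filter_mono nhdsWithin_le_nhds
  obtain ⟨ε, he, hpos⟩ := (h2.and self_mem_nhdsWithin).exists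
  have := P.face_supp c _ (interior_subset he)
  rw [add_dotProduct, smul_dotProduct, P.Fnormal_unit] at this
  have hpos' : 0 < ε := hpos
  simp at this
  linarith

/-- The polyhedron is the intersection of the half-spaces of its faces. -/
lemma mem_of_halfspaces (P : PolyCtx) {x : V3}
    (h : ∀ c, x ⬝ᵥ P.Fnormal c ≤ P.foffset c) : x ∈ P.Pbar := by
  by_contra hx
  obtain ⟨y, hy⟩ := P.int_nonempty
  have hseg : IsPreconnected (segment ℝ y x) := (convex_segment y x).isPreconnected
  obtain ⟨q, hq, hqf⟩ : ∃ q ∈ segment ℝ y x, q ∈ frontier P.Pbar := by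
    by_contra hno
    push Not at hno
    obtain ⟨r, -, hr1, hr2⟩ := hseg (interior P.Pbar) P.Pbarᶜ isOpen_interior
      P.compact.isClosed.isOpen_compl
      (fun r hr => by
        by_cases hrP : r ∈ P.Pbar
        · left
          by_contra hri
          exact hno r hr ⟨subset_closure hrP, hri⟩
        · exact Or.inr hrP)
      ⟨y, left_mem_segment ℝ y x, hy⟩ ⟨x, right_mem_segment ℝ y x, hx⟩
    exact hr2 (interior_subset hr1)
  have hqP : q ∈ P.Pbar := P.compact.isClosed.frontier_subset hqf
  rw [P.frontier_eq, Set.mem_iUnion] at hqf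
  obtain ⟨c, hc⟩ := hqf
  rw [P.face_def] at hc
  obtain ⟨α, β, hα, hβ, hab, rfl⟩ := hq
  have h1 := hc.2
  simp only [add_dotProduct, smul_dotProduct, smul_eq_mul] at h1
  have h2 := P.interior_lt hy c
  have h3 := h c
  have hα' : 0 < α := by
    rcases hα.lt_or_eq with h | h
    · exact h
    · exfalso
      subst h
      have : β = 1 := by linarith
      subst this
      simp at hqP
      exact hx hqP
  have hb : β = 1 - α := by linarith
  subst hb
  nlinarith

/-- A point of a face at which a tangential ray leaves the polyhedron lies on a second,
non-parallel face. -/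
lemma exists_second_face (P : PolyCtx) {p d : V3} (c : Fin P.nf) (hp : p ∈ P.Pbar)
    (hd : d ⬝ᵥ P.Fnormal c = 0) (hout : ∀ ε : ℝ, 0 < ε → p + ε • d ∉ P.Pbar) :
    ∃ c', p ∈ P.face c' ∧ crossProduct (P.Fnormal c) (P.Fnormal c') ≠ 0 := by
  by_contra hcon
  push Not at hcon
  have key : ∀ c', ∀ᶠ ε in nhdsWithin (0 : ℝ) (Set.Ioi 0),
      (p + ε • d) ⬝ᵥ P.Fnormal c' ≤ P.foffset c' := by
    intro c'
    rcases (P.face_supp c' p hp).lt_or_eq with h | h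
    · have hc : Continuous fun ε : ℝ => (p + ε • d) ⬝ᵥ P.Fnormal c' := by
        simp only [add_dotProduct, smul_dotProduct, smul_eq_mul]; fun_prop
      have : ∀ᶠ ε in nhds (0 : ℝ), (p + ε • d) ⬝ᵥ P.Fnormal c' < P.foffset c' :=
        hc.continuousAt.eventually_lt continuousAt_const (by simpa using h)
      exact (this.mono fun _ h => h.le).filter_mono nhdsWithin_le_nhds
    · have hf : p ∈ P.face c' := by rw [P.face_def]; exact ⟨hp, h⟩
      have h2 := eq_smul_of_cross_zero (P.Fnormal_unit c) (hcon c' hf)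
      have h3 : d ⬝ᵥ P.Fnormal c' = 0 := by
        rw [h2, dotProduct_smul, hd, smul_zero]
      refine Filter.Eventually.of_forall fun ε => ?_
      rw [add_dotProduct, smul_dotProduct, h3, h]; simp
  have := (Filter.eventually_all.2 key).and self_mem_nhdsWithin
  obtain ⟨ε, he, hpos⟩ := this.exists
  exact hout ε hpos (P.mem_of_halfspaces he)

lemma mem_Bhat (P : PolyCtx) (a : Fin P.nv) (c : Fin P.nf) (x : V3) :
    x ∈ P.Bhat a c ↔
      x ∈ P.Pbar ∧ x ⬝ᵥ P.Fnormal c = P.foffset c ∧ (x - P.cpt a) ⬝ᵥ P.Cnormal a = 0 := by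
  constructor
  · rintro ⟨⟨h1, h2⟩, h3, h4⟩
    rw [P.face_def] at h3
    exact ⟨h3.1, h3.2, h1⟩
  · rintro ⟨h1, h2, h3⟩
    refine ⟨⟨h3, h1, ?_⟩, ?_, ?_⟩
    · rintro ⟨b, rfl⟩
      by_cases hb : b = a
      · subst hb; exact (P.sep_vert b).ne' h3
      · exact (P.sep_other a b hb).ne h3
    · rw [P.face_def]; exact ⟨h1, h2⟩
    · exact Set.mem_iInter.2 fun a' => P.cleave_sub a a' x h1 h3

lemma Bhat_sub_Phat (P : PolyCtx) (a : Fin P.nv) (c : Fin P.nf) : P.Bhat a c ⊆ P.PhatSet :=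
  fun _ h => ⟨h.1.2, h.2.2⟩

lemma convex_Bhat (P : PolyCtx) (a : Fin P.nv) (c : Fin P.nf) : Convex ℝ (P.Bhat a c) := by
  intro x hx y hy α β hα hβ hab
  rw [mem_Bhat] at *
  obtain ⟨h1, h2, h3⟩ := hx
  obtain ⟨g1, g2, g3⟩ := hy
  have hb : β = 1 - α := by linarith
  refine ⟨P.convex h1 g1 hα hβ hab, ?_, ?_⟩
  · rw [add_dotProduct, smul_dotProduct, smul_dotProduct, h2, g2, hb]; simp; ring
  · simp only [sub_dotProduct, add_dotProduct, smul_dotProduct, smul_eq_mul] at *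
    rw [hb]; linear_combination α * h3 + (1 - α) * g3

lemma fvert_mem (P : PolyCtx) (c : Fin P.nf) (i : ℕ) : P.vert (P.fvert c i) ∈ P.face c := by
  apply P.fedge_sub c i
  rw [P.fedge_seg]
  exact left_mem_segment ℝ _ _

lemma cross_ne (P : PolyCtx) {a : Fin P.nv} {c : Fin P.nf} {x : V3} (hx : x ∈ P.Bhat a c) :
    crossProduct (P.Fnormal c) (P.Cnormal a) ≠ 0 := by
  intro h
  rw [mem_Bhat] at hx
  obtain ⟨h1, h2, h3⟩ := hx
  have h4 := eq_smul_of_cross_zero (P.Fnormal_unit c) h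
  have hv := P.fvert_mem c 0
  rw [P.face_def] at hv
  have hv2 := hv.2
  have : (P.vert (P.fvert c 0) - P.cpt a) ⬝ᵥ P.Cnormal a = 0 := by
    rw [h4] at h3 ⊢
    simp only [sub_dotProduct, dotProduct_smul, smul_eq_mul] at *
    rw [hv2, ← h2]; exact h3
  by_cases hb : P.fvert c 0 = a
  · rw [hb] at this; exact (P.sep_vert a).ne' this
  · exact (P.sep_other a _ hb).ne this

/-- There is a point of the truncated face off the cleaving plane. -/
lemma exists_off (P : PolyCtx) (a : Fin P.nv) (c : Fin P.nf) :
    ∃ q ∈ P.Fhat c, (q - P.cpt a) ⬝ᵥ P.Cnormal a < 0 := by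
  have hm := P.m_ge c
  obtain ⟨u, w, hu, hw, huw, hfu, hfw⟩ : ∃ u w, u ≠ a ∧ w ≠ a ∧ w ≠ u ∧
      P.vert u ∈ P.face c ∧ P.vert w ∈ P.face c := by
    have h01 := P.fvert_inj c 0 1 (by norm_num) (by omega)
    have h02 := P.fvert_inj c 0 2 (by norm_num) (by omega)
    have h12 := P.fvert_inj c 1 2 (by norm_num) (by omega)
    by_cases h0 : P.fvert c 0 = a
    · exact ⟨_, _, fun h => h01 (h0.trans h.symm), fun h => h02 (h0.trans h.symm), h12.symm,
        P.fvert_mem c 1, P.fvert_mem c 2⟩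
    · by_cases h1 : P.fvert c 1 = a
      · exact ⟨_, _, h0, fun h => h12 (h1.trans h.symm), h02.symm,
          P.fvert_mem c 0, P.fvert_mem c 2⟩
      · exact ⟨_, _, h0, h1, h01.symm, P.fvert_mem c 0, P.fvert_mem c 1⟩
  have hα := P.sep_vert u
  have hβ := P.sep_other u w huw
  have ga := P.sep_other a u hu
  have gb := P.sep_other a w hw
  rw [P.face_def] at hfu hfw
  set α := (P.vert u - P.cpt u) ⬝ᵥ P.Cnormal u with hαd
  set β := (P.vert w - P.cpt u) ⬝ᵥ P.Cnormal u with hβd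
  have hpos : 0 < α - β := by linarith
  set s := -β / (α - β) with hs
  set t := α / (α - β) with ht
  have hs0 : 0 < s := div_pos (by linarith) hpos
  have ht0 : 0 < t := div_pos hα hpos
  have hst : s + t = 1 := by rw [hs, ht]; field_simp; ring
  have hz : s * α + t * β = 0 := by rw [hs, ht]; field_simp; ring
  have hs1 : s = 1 - t := by linarith
  have hqP : s • P.vert u + t • P.vert w ∈ P.Pbar :=
    P.convex hfu.1 hfw.1 hs0.le ht0.le hst
  have aff : ∀ r C : V3, (s • P.vert u + t • P.vert w - r) ⬝ᵥ C
      = s * ((P.vert u - r) ⬝ᵥ C) + t * ((P.vert w - r) ⬝ᵥ C) := by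
    intro r C
    simp only [sub_dotProduct, add_dotProduct, smul_dotProduct, smul_eq_mul]
    rw [hs1]; ring
  have hqC : (s • P.vert u + t • P.vert w - P.cpt u) ⬝ᵥ P.Cnormal u = 0 := by
    rw [aff]; exact hz
  refine ⟨s • P.vert u + t • P.vert w, ⟨?_, ?_⟩, ?_⟩
  · rw [P.face_def]
    refine ⟨hqP, ?_⟩
    rw [add_dotProduct, smul_dotProduct, smul_dotProduct, hfu.2, hfw.2, hs1]
    simp; ring
  · exact Set.mem_iInter.2 fun a' => P.cleave_sub u a' _ hqP hqC
  · rw [aff]; nlinarith [mul_pos hs0 (neg_pos.2 ga), mul_pos ht0 (neg_pos.2 gb)]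

/-- The coordinate along the line containing the cleaved edge. -/
def lcoord (P : PolyCtx) (a : Fin P.nv) (c : Fin P.nf) (x : V3) : ℝ :=
  x ⬝ᵥ crossProduct (P.Fnormal c) (P.Cnormal a)

lemma lcoord_inj (P : PolyCtx) {a : Fin P.nv} {c : Fin P.nf} {x y : V3} (hx : x ∈ P.Bhat a c)
    (hy : y ∈ P.Bhat a c) (h : P.lcoord a c x = P.lcoord a c y) : x = y := by
  have hne := P.cross_ne hx
  rw [mem_Bhat] at hx hy
  obtain ⟨-, h2, h3⟩ := hx
  obtain ⟨-, g2, g3⟩ := hy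
  have w1 : (x - y) ⬝ᵥ P.Fnormal c = 0 := by rw [sub_dotProduct, h2, g2, sub_self]
  have w2 : (x - y) ⬝ᵥ P.Cnormal a = 0 := by
    simp only [sub_dotProduct] at *; linarith
  have w3 : (x - y) ⬝ᵥ crossProduct (P.Fnormal c) (P.Cnormal a) = 0 := by
    unfold lcoord at h; rw [sub_dotProduct, h, sub_self]
  have hz : crossProduct (x - y) (crossProduct (P.Fnormal c) (P.Cnormal a)) = 0 := by
    have : crossProduct (x - y) (crossProduct (P.Fnormal c) (P.Cnormal a))
        = ((x - y) ⬝ᵥ P.Cnormal a) • P.Fnormal c - ((x - y) ⬝ᵥ P.Fnormal c) • P.Cnormal a := by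
      generalize x - y = w
      apply v3_ext <;> simp [cross_apply, dot_three] <;> ring
    rw [this, w1, w2]; simp
  have hl := lagrange_three (x - y) (crossProduct (P.Fnormal c) (P.Cnormal a))
  rw [hz, w3] at hl
  have hp := dot_self_pos hne
  apply sub_eq_zero.1
  by_contra hxy
  have hp2 := dot_self_pos hxy
  have := mul_pos hp2 hp
  rw [zero_dotProduct, sub_zero] at hl
  nlinarith

lemma second_face_max (P : PolyCtx) {a : Fin P.nv} {c : Fin P.nf} {p : V3} (hp : p ∈ P.Bhat a c)
    (hm : (∀ x ∈ P.Bhat a c, P.lcoord a c x ≤ P.lcoord a c p) ∨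
      ∀ x ∈ P.Bhat a c, P.lcoord a c p ≤ P.lcoord a c x) :
    ∃ c', p ∈ P.face c' ∧ crossProduct (P.Fnormal c) (P.Fnormal c') ≠ 0 := by
  have hne := P.cross_ne hp
  have hpos := dot_self_pos hne
  have hp' := (P.mem_Bhat a c p).1 hp
  set d := crossProduct (P.Fnormal c) (P.Cnormal a) with hd
  have hdF : d ⬝ᵥ P.Fnormal c = 0 := by
    rw [hd]; simp only [dot_three, cross_apply]; simp; ring
  have hdC : d ⬝ᵥ P.Cnormal a = 0 := by
    rw [hd]; simp only [dot_three, cross_apply]; simp; ring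
  have hmem : ∀ r : ℝ, p + r • d ∈ P.Pbar → p + r • d ∈ P.Bhat a c := by
    intro r hr
    rw [mem_Bhat]
    refine ⟨hr, ?_, ?_⟩
    · rw [add_dotProduct, smul_dotProduct, hdF, hp'.2.1]; simp
    · have := hp'.2.2
      simp only [sub_dotProduct, add_dotProduct, smul_dotProduct, hdC] at *
      simp; linarith
  have hl : ∀ r : ℝ, P.lcoord a c (p + r • d) = P.lcoord a c p + r * (d ⬝ᵥ d) := by
    intro r
    unfold lcoord
    rw [add_dotProduct, smul_dotProduct, smul_eq_mul]
  rcases hm with hm | hm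
  · refine P.exists_second_face (d := d) c hp'.1 hdF fun ε hε hin => ?_
    have := hm _ (hmem ε hin)
    rw [hl] at this
    nlinarith [mul_pos hε hpos]
  · refine P.exists_second_face (d := -d) c hp'.1 (by simp [hdF]) fun ε hε hin => ?_
    rw [smul_neg, ← neg_smul] at hin
    have := hm _ (hmem (-ε) hin)
    rw [hl] at this
    nlinarith [mul_pos hε hpos]

lemma param_mem (P : PolyCtx) {a : Fin P.nv} {c : Fin P.nf} {z : ℝ → V3}
    (hz : P.IsPosParamSeg a c z) {t : ℝ} (ht : t ∈ Set.Icc (0 : ℝ) 1) : z t ∈ P.Bhat a c := by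
  rw [← hz.2.1]; exact ⟨t, ht, rfl⟩

lemma param_ends (P : PolyCtx) {a : Fin P.nv} {c : Fin P.nf} {z : ℝ → V3}
    (hz : P.IsPosParamSeg a c z) :
    (∀ x ∈ P.Bhat a c, P.lcoord a c (z 0) ≤ P.lcoord a c x ∧
      P.lcoord a c x ≤ P.lcoord a c (z 1)) ∨
    (∀ x ∈ P.Bhat a c, P.lcoord a c (z 1) ≤ P.lcoord a c x ∧
      P.lcoord a c x ≤ P.lcoord a c (z 0)) := by
  obtain ⟨h1, h2, h3, -⟩ := id hz
  have hc : ContinuousOn (fun t => P.lcoord a c (z t)) (Set.Icc 0 1) := by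
    have : Continuous (P.lcoord a c) := by
      unfold lcoord
      exact continuous_id.dotProduct continuous_const
    exact this.comp_continuousOn h1
  have hi : Set.InjOn (fun t => P.lcoord a c (z t)) (Set.Icc 0 1) := by
    intro s hs t ht hst
    exact h3 hs ht (P.lcoord_inj (P.param_mem hz hs) (P.param_mem hz ht) hst)
  rcases ContinuousOn.strictMonoOn_of_injOn_Icc' zero_le_one hc hi with h | h
  · left
    intro x hx
    rw [← h2] at hx
    obtain ⟨t, ht, rfl⟩ := hx
    exact ⟨h.monotoneOn (by simp) ht ht.1, h.monotoneOn ht (by simp) ht.2⟩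
  · right
    intro x hx
    rw [← h2] at hx
    obtain ⟨t, ht, rfl⟩ := hx
    exact ⟨h.antitoneOn ht (by simp) ht.2, h.antitoneOn (by simp) ht ht.1⟩

lemma param_ne (P : PolyCtx) {a : Fin P.nv} {c : Fin P.nf} {z : ℝ → V3}
    (hz : P.IsPosParamSeg a c z) : z 0 ≠ z 1 := fun h => by
  have := hz.2.2.1 (by simp) (by simp) h
  norm_num at this

/-- Opposite endpoint orders cannot both be positively oriented. -/
lemma not_opposite (P : PolyCtx) {a : Fin P.nv} {c : Fin P.nf} {z z' : ℝ → V3}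
    (hz : P.IsPosParamSeg a c z) (hz' : P.IsPosParamSeg a c z') (h0 : z' 0 = z 1)
    (h1 : z' 1 = z 0) : False := by
  obtain ⟨q, hq, hqn⟩ := P.exists_off a c
  have k1 := hz.2.2.2 q hq
  have k2 := hz'.2.2.2 q hq
  rw [h0, h1] at k2
  have m0 := (P.mem_Bhat a c _).1 (P.param_mem hz (t := 0) (by simp))
  have m1 := (P.mem_Bhat a c _).1 (P.param_mem hz (t := 1) (by simp))
  have hne : z 1 - z 0 ≠ 0 := fun h => P.param_ne hz (sub_eq_zero.1 h).symm
  have hqF := hq.1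
  rw [P.face_def] at hqF
  set F := P.Fnormal c
  set C := P.Cnormal a
  have hF : F ⬝ᵥ F = 1 := P.Fnormal_unit c
  obtain ⟨u, hu⟩ : ∃ u, u = z 1 - z 0 := ⟨_, rfl⟩
  obtain ⟨w, hw⟩ : ∃ w, w = q - z 0 := ⟨_, rfl⟩
  have uF : u ⬝ᵥ F = 0 := by rw [hu, sub_dotProduct, m0.2.1, m1.2.1, sub_self]
  have wF : w ⬝ᵥ F = 0 := by rw [hw, sub_dotProduct, m0.2.1, hqF.2, sub_self]
  have uC : u ⬝ᵥ C = 0 := by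
    have e0 := m0.2.2
    have e1 := m1.2.2
    rw [hu]; simp only [sub_dotProduct] at *; linarith
  have wC : w ⬝ᵥ C < 0 := by
    have e0 := m0.2.2
    rw [hw]; simp only [sub_dotProduct] at *; linarith
  have wW : w ⬝ᵥ crossProduct F u = 0 := by
    rw [← hu, ← hw] at k1
    have e1 : q - z 1 = w - u := by rw [hu, hw]; abel
    have e2 : z 0 - z 1 = -u := by rw [hu]; abel
    rw [e1, e2] at k2
    have : (w - u) ⬝ᵥ crossProduct F (-u) = - (w ⬝ᵥ crossProduct F u) := by
      simp only [dot_three, cross_apply]; simp; ring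
    rw [this] at k2
    linarith
  have hwu : crossProduct w u = 0 := by
    have : (F ⬝ᵥ F) • crossProduct w u
        = (u ⬝ᵥ F) • crossProduct w F + (w ⬝ᵥ F) • crossProduct F u
          - (w ⬝ᵥ crossProduct F u) • F := by
      have hk : w ⬝ᵥ crossProduct F u = w 0 * (F 1 * u 2 - F 2 * u 1)
          + w 1 * (F 2 * u 0 - F 0 * u 2) + w 2 * (F 0 * u 1 - F 1 * u 0) := by
        simp only [dot_three, cross_apply]; simp
      rw [hk]
      apply v3_ext <;> simp [cross_apply, dot_three] <;> ring
    rw [hF, uF, wF, wW] at this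
    simpa using this
  have hfin : (u ⬝ᵥ u) * (w ⬝ᵥ C) = (w ⬝ᵥ u) * (u ⬝ᵥ C) - crossProduct w u ⬝ᵥ crossProduct u C := by
    simp only [dot_three, cross_apply]; simp; ring
  rw [hwu, uC] at hfin
  simp at hfin
  rcases hfin with h | h
  · exact hne (hu ▸ h)
  · exact wC.ne h

lemma same_ends (P : PolyCtx) {a : Fin P.nv} {c : Fin P.nf} {z z' : ℝ → V3}
    (hz : P.IsPosParamSeg a c z) (hz' : P.IsPosParamSeg a c z') : z 0 = z' 0 ∧ z 1 = z' 1 := by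
  have m0 := P.param_mem hz (t := 0) (by simp)
  have m1 := P.param_mem hz (t := 1) (by simp)
  have m0' := P.param_mem hz' (t := 0) (by simp)
  have m1' := P.param_mem hz' (t := 1) (by simp)
  rcases P.param_ends hz with h | h <;> rcases P.param_ends hz' with h' | h'
  · exact ⟨P.lcoord_inj m0 m0' (le_antisymm (h _ m0').1 (h' _ m0).1),
      P.lcoord_inj m1 m1' (le_antisymm (h' _ m1).2 (h _ m1').2)⟩
  · exact (P.not_opposite hz hz' (P.lcoord_inj m0' m1 (le_antisymm (h _ m0').2 (h' _ m1).2))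
      (P.lcoord_inj m1' m0 (le_antisymm (h' _ m0).1 (h _ m1').1))).elim
  · exact (P.not_opposite hz hz' (P.lcoord_inj m0' m1 (le_antisymm (h' _ m1).1 (h _ m0').1))
      (P.lcoord_inj m1' m0 (le_antisymm (h _ m1').2 (h' _ m0).2))).elim
  · exact ⟨P.lcoord_inj m0 m0' (le_antisymm (h' _ m0).2 (h _ m0').2),
      P.lcoord_inj m1 m1' (le_antisymm (h _ m1').1 (h' _ m1).1)⟩

/-- Along a homotopy the field is constant at a point lying on two non-parallel faces. -/
lemma const_on_edge (P : PolyCtx) {a : Fin P.nv} {c c' : Fin P.nf} {p : V3}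
    (hp : p ∈ P.Bhat a c) (hp' : p ∈ P.face c')
    (hcr : crossProduct (P.Fnormal c) (P.Fnormal c') ≠ 0) {H : ℝ → V3 → V3}
    (hc : ContinuousOn (fun q : ℝ × V3 => H q.1 q.2) (Set.Icc (0:ℝ) 1 ×ˢ P.PhatSet))
    (hm : ∀ t ∈ Set.Icc (0:ℝ) 1, P.MemC0Phat (H t)) :
    ∀ t ∈ Set.Icc (0:ℝ) 1, H t p = H 0 p := by
  have hP := P.Bhat_sub_Phat a c hp
  have hu : ∀ t ∈ Set.Icc (0:ℝ) 1, H t p ⬝ᵥ H t p = 1 := fun t ht => (hm t ht).2.1 p hP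
  have h1 : ∀ t ∈ Set.Icc (0:ℝ) 1, H t p ⬝ᵥ P.Fnormal c = 0 := fun t ht =>
    (hm t ht).2.2 c p hp.2
  have h2 : ∀ t ∈ Set.Icc (0:ℝ) 1, H t p ⬝ᵥ P.Fnormal c' = 0 := fun t ht =>
    (hm t ht).2.2 c' p ⟨hp', hp.2.2⟩
  have z0 : (0 : ℝ) ∈ Set.Icc (0:ℝ) 1 := by simp
  have hcont : ContinuousOn (fun t : ℝ => H t p) (Set.Icc 0 1) :=
    hc.comp (f := fun t : ℝ => (t, p)) (by fun_prop) fun t ht => ⟨ht, hP⟩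
  have hg : ContinuousOn (fun t : ℝ => H t p ⬝ᵥ H 0 p) (Set.Icc 0 1) := by
    have : Continuous fun x : V3 => x ⬝ᵥ H 0 p := continuous_id.dotProduct continuous_const
    exact this.comp_continuousOn hcont
  have hsq : ∀ t ∈ Set.Icc (0:ℝ) 1, (H t p ⬝ᵥ H 0 p) ^ 2 = 1 := fun t ht =>
    dot_sq_eq_one hcr (hu t ht) (hu 0 z0) (h1 t ht) (h2 t ht) (h1 0 z0) (h2 0 z0)
  intro t ht
  apply eq_of_dot_eq_one (hu t ht) (hu 0 z0)
  rcases isPreconnected_Icc.eq_one_or_eq_neg_one_of_sq_eq hg (fun s hs => hsq s hs) with h | h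
  · exact h ht
  · have := h z0
    simp only [Pi.neg_apply, Pi.one_apply] at this
    rw [hu 0 z0] at this
    norm_num at this

end PolyCtx

/-- Kink numbers are homotopy invariants: homotopic fields in `C⁰(P̂)`
have the same kink number on every cleaved edge. -/
theorem stmt_17 (P : PolyCtx) (n n' : V3 → V3)
    (hn : P.MemC0Phat n) (hn' : P.MemC0Phat n')
    (hhom : P.HomotopicPhat n n') (a : Fin P.nv) (c : Fin P.nf) (κ κ' : ℤ)
    (hκ : P.HasKink a c n κ) (hκ' : P.HasKink a c n' κ') :
    κ = κ' := by
  obtain ⟨z, hz, ξ, hξc, hξ0, hξ, η, hη, hηe, hk⟩ := hκ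
  obtain ⟨z', hz', ξ', hξc', hξ0', hξ', η', hη', hηe', hk'⟩ := hκ'
  obtain ⟨H, hHc, hHm, hH0, hH1⟩ := hhom
  obtain ⟨e0, e1⟩ := P.same_ends hz hz'
  have m0 := P.param_mem hz (t := 0) (by simp)
  have m1 := P.param_mem hz (t := 1) (by simp)
  obtain ⟨c0, hc0, hx0⟩ : ∃ c', z 0 ∈ P.face c' ∧
      crossProduct (P.Fnormal c) (P.Fnormal c') ≠ 0 := by
    apply P.second_face_max m0
    rcases P.param_ends hz with h | h
    · exact Or.inr fun x hx => (h x hx).1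
    · exact Or.inl fun x hx => (h x hx).2
  obtain ⟨c1, hc1, hx1⟩ : ∃ c', z 1 ∈ P.face c' ∧
      crossProduct (P.Fnormal c) (P.Fnormal c') ≠ 0 := by
    apply P.second_face_max m1
    rcases P.param_ends hz with h | h
    · exact Or.inl fun x hx => (h x hx).2
    · exact Or.inr fun x hx => (h x hx).1
  have k0 := P.const_on_edge m0 hc0 hx0 hHc hHm
  have k1 := P.const_on_edge m1 hc1 hx1 hHc hHm
  have p0 := P.Bhat_sub_Phat a c m0
  have p1 := P.Bhat_sub_Phat a c m1
  have one_mem : (1 : ℝ) ∈ Set.Icc (0 : ℝ) 1 := by simp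
  have n0 : n' (z' 0) = n (z 0) := by
    rw [← e0, ← hH1 _ p0, k0 1 one_mem, hH0 _ p0]
  have n1 : n' (z' 1) = n (z 1) := by
    rw [← e1, ← hH1 _ p1, k1 1 one_mem, hH0 _ p1]
  have hF := P.Fnormal_unit c
  have he : n (z 0) ⬝ᵥ n (z 0) = 1 := hn.2.1 _ p0
  have hFe : n (z 0) ⬝ᵥ P.Fnormal c = 0 := hn.2.2 c _ m0.2
  have hηη : η = η' := by
    apply eta_unique hF he hFe hη hη'
    rw [← hηe, ← n1, hηe', n0]
  let g : unitInterval × unitInterval → V3 := fun q =>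
    (1 - (q.2 : ℝ)) • z q.1 + (q.2 : ℝ) • z' q.1
  have hgB : ∀ q, g q ∈ P.Bhat a c := fun q =>
    P.convex_Bhat a c (P.param_mem hz q.1.2) (P.param_mem hz' q.1.2)
      (by have := q.2.2.2; linarith) q.2.2.1 (by ring)
  have hzc : Continuous fun s : unitInterval => z s :=
    continuousOn_iff_continuous_domRestrict.1 hz.1
  have hzc' : Continuous fun s : unitInterval => z' s :=
    continuousOn_iff_continuous_domRestrict.1 hz'.1
  have hgc : Continuous g := by
    have a1 : Continuous fun q : unitInterval × unitInterval => z q.1 := hzc.comp continuous_fst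
    have a2 : Continuous fun q : unitInterval × unitInterval => z' q.1 := hzc'.comp continuous_fst
    have a3 : Continuous fun q : unitInterval × unitInterval => (q.2 : ℝ) := by fun_prop
    exact ((continuous_const.sub a3).smul a1).add (a3.smul a2)
  have hpair : Continuous fun q : unitInterval × unitInterval => ((q.2 : ℝ), g q) :=
    Continuous.prodMk (by fun_prop) hgc
  have hξξ : ξ 1 = ξ' 1 := by
    refine angle_homotopy hF he hFe (fun q => H q.2 (g q)) ?_ ?_ ?_ ?_ (n (z 1)) ?_ ξ ξ' hξc hξc'
      hξ0 hξ0' ?_ ?_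
    · exact hHc.comp_continuous hpair fun q => ⟨q.2.2, P.Bhat_sub_Phat a c (hgB q)⟩
    · exact fun q => (hHm _ q.2.2).2.1 _ (P.Bhat_sub_Phat a c (hgB q))
    · exact fun q => (hHm _ q.2.2).2.2 c _ (hgB q).2
    · intro t
      have : g (0, t) = z 0 := by
        simp only [g, Set.Icc.coe_zero, ← e0, ← add_smul]; simp
      show H t (g (0, t)) = _
      rw [this, k0 _ t.2, hH0 _ p0]
    · intro t
      have : g (1, t) = z 1 := by
        simp only [g, Set.Icc.coe_one, ← e1, ← add_smul]; simp
      show H t (g (1, t)) = _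
      rw [this, k1 _ t.2, hH0 _ p1]
    · intro s
      have : g (s, 0) = z s := by simp [g]
      show H ((0 : unitInterval) : ℝ) (g (s, 0)) = _
      rw [this, Set.Icc.coe_zero, hH0 _ (P.Bhat_sub_Phat a c (P.param_mem hz s.2))]
      exact hξ s s.2
    · intro s
      have : g (s, 1) = z' s := by simp [g]
      show H ((1 : unitInterval) : ℝ) (g (s, 1)) = _
      rw [this, Set.Icc.coe_one, hH1 _ (P.Bhat_sub_Phat a c (P.param_mem hz' s.2)), ← n0]
      exact hξ' s s.2
  have hpi := Real.pi_pos
  have : (κ : ℝ) = κ' := by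
    have : 2 * Real.pi * (κ : ℝ) = 2 * Real.pi * κ' := by rw [hk, hk', hξξ, hηη]
    exact mul_left_cancel₀ (by positivity) this
  exact_mod_cast this
end
end

section
/- Wrapping numbers are homotopy invariants: if n̂, n̂' ∈ C⁰(P̂) are homotopic in C⁰(P̂), then w^a(n̂) = w^a(n̂') for every cleaved face Ĉ^a. (Along a homotopy H_t in C⁰(P̂), the glued maps ν^a ∘ ν₀^a built from H_t vary continuously, so their degree is constant.) -/
open Matrix Set MeasureTheory
open scoped Classical

noncomputable section

lemma w18_contOn_of_comp {X Y Z : Type*} [TopologicalSpace X] [TopologicalSpace Y]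
    [TopologicalSpace Z] [T2Space Y] {K : Set X} (hK : IsCompact K) {Q : X → Y}
    (hQ : ContinuousOn Q K) {f : Y → Z} (hf : ContinuousOn (fun x => f (Q x)) K) :
    ContinuousOn f (Q '' K) := by
  rw [continuousOn_iff_isClosed] at hf ⊢
  intro t ht
  obtain ⟨u, hu, he⟩ := hf t ht
  refine ⟨Q '' (u ∩ K), ((hK.inter_left hu).image_of_continuousOn
    (hQ.mono Set.inter_subset_right)).isClosed, ?_⟩
  ext y
  constructor
  · rintro ⟨hy, x, hx, rfl⟩
    have : x ∈ u ∩ K := by rw [← he]; exact ⟨hy, hx⟩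
    exact ⟨⟨x, this, rfl⟩, x, hx, rfl⟩
  · rintro ⟨⟨x, hx, rfl⟩, -⟩
    refine ⟨?_, x, hx.2, rfl⟩
    rw [← he] at hx
    exact hx.1

lemma w18_cont_of_graph {X Y : Type*} [TopologicalSpace X] [TopologicalSpace Y]
    {B : Set Y} (hB : IsCompact B) (f : X → Y)
    (G : Set (X × Y)) (hG : IsClosed G) (h1 : ∀ x, f x ∈ B) (h2 : ∀ x, (x, f x) ∈ G)
    (h3 : ∀ x y, y ∈ B → (x, y) ∈ G → y = f x) : Continuous f := by
  rw [continuous_iff_isClosed]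
  intro t ht
  have : CompactSpace B := isCompact_iff_compactSpace.mp hB
  have hcl : IsClosed {q : X × B | ((q.1, (q.2 : Y)) ∈ G) ∧ (q.2 : Y) ∈ t} :=
    (hG.preimage (by fun_prop)).inter (ht.preimage (by fun_prop))
  have := isClosedMap_fst_of_compactSpace _ hcl
  convert this using 1
  ext x
  constructor
  · intro hx
    exact ⟨(x, ⟨f x, h1 x⟩), ⟨h2 x, hx⟩, rfl⟩
  · rintro ⟨⟨x', b⟩, ⟨hq, hq'⟩, rfl⟩
    have := h3 _ _ b.2 hq
    simp only [Set.mem_preimage]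
    rw [← this]; exact hq'

lemma w18_dot_le {p a : V3} (hp : p ∈ sphereS) (ha : a ∈ sphereS) :
    -1 ≤ p ⬝ᵥ a ∧ p ⬝ᵥ a ≤ 1 := by
  simp only [sphereS, Set.mem_ofPred_eq, dotProduct, Fin.sum_univ_three] at *
  constructor
  · nlinarith [sq_nonneg (p 0 + a 0), sq_nonneg (p 1 + a 1), sq_nonneg (p 2 + a 2)]
  · nlinarith [sq_nonneg (p 0 - a 0), sq_nonneg (p 1 - a 1), sq_nonneg (p 2 - a 2)]

lemma w18_dot_one {p a : V3} (hp : p ∈ sphereS) (ha : a ∈ sphereS) (h : p ⬝ᵥ a = 1) : p = a := by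
  simp only [sphereS, Set.mem_ofPred_eq, dotProduct, Fin.sum_univ_three] at *
  ext i
  fin_cases i <;> simp only [Fin.zero_eta, Fin.mk_one, Fin.reduceFinMk] <;> apply eq_of_sub_eq_zero <;> apply pow_eq_zero_iff (two_ne_zero) |>.mp <;>
  nlinarith [sq_nonneg (p 0 - a 0), sq_nonneg (p 1 - a 1), sq_nonneg (p 2 - a 2)]

lemma w18_neg_sphere {s : V3} (hs : s ∈ sphereS) : -s ∈ sphereS := by
  simpa [sphereS] using hs

lemma w18_sinc_ne {p a : V3} (hp : p ∈ sphereS) (ha : a ∈ sphereS) (h : a ≠ -p) :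
    Real.sinc (Real.arccos (p ⬝ᵥ a)) ≠ 0 := by
  by_cases h0 : Real.arccos (p ⬝ᵥ a) = 0
  · simp [h0]
  · rw [Real.sinc_of_ne_zero h0]
    apply div_ne_zero _ h0
    apply ne_of_gt
    apply Real.sin_pos_of_pos_of_lt_pi
    · exact lt_of_le_of_ne (Real.arccos_nonneg _) (Ne.symm h0)
    · apply lt_of_le_of_ne (Real.arccos_le_pi _)
      intro h1
      rw [Real.arccos_eq_pi] at h1
      apply h
      have h2 : (-p) ⬝ᵥ a = 1 := by
        rw [neg_dotProduct]; linarith [(w18_dot_le hp ha).1]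
      exact (w18_dot_one (w18_neg_sphere hp) ha h2).symm

lemma w18_sin_ne {p a : V3} (hp : p ∈ sphereS) (ha : a ∈ sphereS) (h : a ≠ -p) (h' : p ≠ a) :
    Real.arccos (p ⬝ᵥ a) ≠ 0 ∧ Real.sin (Real.arccos (p ⬝ᵥ a)) ≠ 0 := by
  have h0 : Real.arccos (p ⬝ᵥ a) ≠ 0 := by
    rw [Ne, Real.arccos_eq_zero]
    intro h1
    exact h' (w18_dot_one hp ha (le_antisymm (w18_dot_le hp ha).2 h1))
  refine ⟨h0, fun h1 => w18_sinc_ne hp ha h ?_⟩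
  rw [Real.sinc_of_ne_zero h0, h1, zero_div]

lemma w18_sin_eq (x : ℝ) : Real.sin x = x * Real.sinc x := by
  by_cases h : x = 0
  · simp [h]
  · rw [Real.sinc_of_ne_zero h]; field_simp

lemma w18_geo_eq {p a : V3} (hp : p ∈ sphereS) (ha : a ∈ sphereS) (h : a ≠ -p) (ρ : ℝ) :
    geo p a ρ = ((1 - ρ) * Real.sinc ((1 - ρ) * Real.arccos (p ⬝ᵥ a)) /
        Real.sinc (Real.arccos (p ⬝ᵥ a))) • p +
      (ρ * Real.sinc (ρ * Real.arccos (p ⬝ᵥ a)) / Real.sinc (Real.arccos (p ⬝ᵥ a))) • a := by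
  unfold geo
  split_ifs with h'
  · subst h'
    have : p ⬝ᵥ p = 1 := hp
    rw [this]
    simp [← add_smul]
  · obtain ⟨h1, h2⟩ := w18_sin_ne hp ha h h'
    have h3 := w18_sinc_ne hp ha h
    rw [w18_sin_eq ((1 - ρ) * _), w18_sin_eq (ρ * _), w18_sin_eq (Real.arccos (p ⬝ᵥ a))]
    congr 2 <;> field_simp

lemma w18_geo_one {p a : V3} (hp : p ∈ sphereS) (ha : a ∈ sphereS) (h : a ≠ -p) :
    geo p a 1 = a := by
  rw [w18_geo_eq hp ha h]
  have h3 := w18_sinc_ne hp ha h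
  simp [div_self h3]

lemma w18_geo_zero {p a : V3} (hp : p ∈ sphereS) (ha : a ∈ sphereS) (h : a ≠ -p) :
    geo p a 0 = p := by
  rw [w18_geo_eq hp ha h]
  have h3 := w18_sinc_ne hp ha h
  simp [div_self h3]

lemma w18_geo_sphere {p a : V3} (hp : p ∈ sphereS) (ha : a ∈ sphereS) (h : a ≠ -p) (ρ : ℝ) :
    geo p a ρ ∈ sphereS := by
  unfold geo
  split_ifs with h'
  · exact hp
  · obtain ⟨h1, h2⟩ := w18_sin_ne hp ha h h'
    have hc : Real.cos (Real.arccos (p ⬝ᵥ a)) = p ⬝ᵥ a :=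
      Real.cos_arccos (w18_dot_le hp ha).1 (w18_dot_le hp ha).2
    set θ := Real.arccos (p ⬝ᵥ a) with hθ
    have hp' : p ⬝ᵥ p = 1 := hp
    have ha' : a ⬝ᵥ a = 1 := ha
    have hap : a ⬝ᵥ p = p ⬝ᵥ a := dotProduct_comm _ _
    simp only [sphereS, Set.mem_ofPred_eq, add_dotProduct, dotProduct_add, smul_dotProduct,
      dotProduct_smul, smul_eq_mul, hp', ha', hap, ← hc]
    have e : Real.sin ((1 - ρ) * θ) = Real.sin θ * Real.cos (ρ * θ) - Real.cos θ * Real.sin (ρ * θ) := by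
      rw [← Real.sin_sub]; ring_nf
    rw [e]
    field_simp
    have e1 := Real.sin_sq_add_cos_sq θ
    have e2 := Real.sin_sq_add_cos_sq (ρ * θ)
    have e1' : Real.cos θ ^ 2 = 1 - Real.sin θ ^ 2 := by linarith
    have e2' : Real.cos (ρ * θ) ^ 2 = 1 - Real.sin (ρ * θ) ^ 2 := by linarith
    ring_nf
    simp only [e1', e2']
    ring

lemma w18_arg (ρ φ : ℝ) (hρ : 0 < ρ) (hφ : φ ∈ Set.Icc (-Real.pi) Real.pi) {W : Type*} (z : ℝ → W)
    (hz : ∀ φ, z (φ + 2 * Real.pi) = z φ) :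
    z (Complex.arg (((ρ * Real.cos φ : ℝ) : ℂ) + ((ρ * Real.sin φ : ℝ) : ℂ) * Complex.I)) = z φ := by
  have e : (((ρ * Real.cos φ : ℝ) : ℂ) + ((ρ * Real.sin φ : ℝ) : ℂ) * Complex.I) =
    (ρ : ℂ) * (Complex.cos φ + Complex.sin φ * Complex.I) := by push_cast; ring
  rw [e]
  by_cases h : φ = -Real.pi
  · subst h
    have e2 : Complex.cos ((-Real.pi : ℝ) : ℂ) + Complex.sin ((-Real.pi : ℝ) : ℂ) * Complex.I =
      Complex.cos (Real.pi : ℂ) + Complex.sin (Real.pi : ℂ) * Complex.I := by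
      push_cast; simp
    rw [e2, Complex.arg_mul_cos_add_sin_mul_I hρ ⟨by linarith [Real.pi_pos], le_rfl⟩, ← hz (-Real.pi)]
    congr 1; ring
  · rw [Complex.arg_mul_cos_add_sin_mul_I hρ ⟨lt_of_le_of_ne hφ.1 (Ne.symm h), hφ.2⟩]

lemma w18_sqrt (ρ φ : ℝ) (hρ : 0 ≤ ρ) :
    Real.sqrt ((ρ * Real.cos φ) ^ 2 + (ρ * Real.sin φ) ^ 2) = ρ := by
  have : (ρ * Real.cos φ) ^ 2 + (ρ * Real.sin φ) ^ 2 = ρ ^ 2 := by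
    have := Real.sin_sq_add_cos_sq φ
    linear_combination ρ ^ 2 * this
  rw [this, Real.sqrt_sq hρ]

/-- Polar parametrization of a hemisphere. -/
def w18Q (ε : ℝ) (q : ℝ × ℝ × ℝ) : ℝ × V3 :=
  (q.1, ![q.2.1 * Real.cos q.2.2, q.2.1 * Real.sin q.2.2, ε * Real.sqrt (1 - q.2.1 ^ 2)])

/-- The compact parameter domain. -/
def w18K : Set (ℝ × ℝ × ℝ) :=
  Set.Icc (0:ℝ) 1 ×ˢ (Set.Icc (0:ℝ) 1 ×ˢ Set.Icc (-Real.pi) Real.pi)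

lemma w18Q_cont (ε : ℝ) : Continuous (w18Q ε) := by
  unfold w18Q
  refine continuous_fst.prodMk (continuous_pi fun i => ?_)
  fin_cases i <;> simp <;> fun_prop

lemma w18K_compact : IsCompact w18K :=
  isCompact_Icc.prod (isCompact_Icc.prod isCompact_Icc)

lemma w18Q_surj (t : ℝ) (ht : t ∈ Set.Icc (0:ℝ) 1) (x : V3) (hx : x ∈ sphereS) (ε : ℝ)
    (hε : ε = 1 ∨ ε = -1) (h : 0 ≤ ε * x 2) : (t, x) ∈ w18Q ε '' w18K := by
  set w : ℂ := ⟨x 0, x 1⟩ with hw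
  have hx' : x 0 * x 0 + x 1 * x 1 + x 2 * x 2 = 1 := by
    simpa [sphereS, dotProduct, Fin.sum_univ_three] using hx
  have hn : ‖w‖ ^ 2 = x 0 * x 0 + x 1 * x 1 := by
    rw [← Complex.normSq_eq_norm_sq, Complex.normSq_apply]
  have hε2 : ε * ε = 1 := by rcases hε with rfl | rfl <;> norm_num
  refine ⟨(t, ‖w‖, Complex.arg w), ⟨ht, ⟨norm_nonneg _, ?_⟩, (Complex.neg_pi_lt_arg w).le,
    Complex.arg_le_pi w⟩, ?_⟩
  · nlinarith [norm_nonneg w, mul_self_nonneg (x 2)]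
  · unfold w18Q
    have e : (1 - ‖w‖ ^ 2) = (ε * x 2) ^ 2 := by
      rw [hn]; linear_combination hx' * (-1) - x 2 ^ 2 * hε2
    refine Prod.ext rfl ?_
    ext i
    fin_cases i
    · simp [Complex.norm_mul_cos_arg, hw]
    · simp [Complex.norm_mul_sin_arg, hw]
    · simp only [e, Real.sqrt_sq h]
      simp [← mul_assoc, hε2]

lemma w18_pos (n : V3 → V3) (z : ℝ → V3) (ctr s x : V3) (h : 0 ≤ x 2) :
    wrapMap n z ctr s x = n ((Real.sqrt ((x 0) ^ 2 + (x 1) ^ 2)) •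
      z (Complex.arg ((x 0 : ℂ) + (x 1 : ℂ) * Complex.I))
      + (1 - Real.sqrt ((x 0) ^ 2 + (x 1) ^ 2)) • ctr) := if_pos h

lemma w18_neg (n : V3 → V3) (z : ℝ → V3) (ctr s x : V3) (h : ¬ 0 ≤ x 2) :
    wrapMap n z ctr s x =
      geo (-s) (n (z (Complex.arg ((x 0 : ℂ) + (x 1 : ℂ) * Complex.I))))
        (Real.sqrt ((x 0) ^ 2 + (x 1) ^ 2)) := if_neg h

theorem w18_wrap (s : V3) (hs : s ∈ sphereS) (A B : Set V3) (H : ℝ → V3 → V3)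
    (hH : ContinuousOn (fun q : ℝ × V3 => H q.1 q.2) (Set.Icc (0:ℝ) 1 ×ˢ A))
    (hHs : ∀ t ∈ Set.Icc (0:ℝ) 1, ∀ x ∈ A, H t x ∈ sphereS)
    (hHB : ∀ t ∈ Set.Icc (0:ℝ) 1, ∀ x ∈ B, H t x ≠ s) (hBA : B ⊆ A)
    (Z : ℝ → ℝ → V3) (hZ : Continuous fun q : ℝ × ℝ => Z q.1 q.2)
    (hZp : ∀ t φ, Z t (φ + 2 * Real.pi) = Z t φ) (hZB : ∀ t φ, Z t φ ∈ B)
    (C : ℝ → V3) (hC : Continuous C)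
    (hseg : ∀ t φ, ∀ ρ ∈ Set.Icc (0:ℝ) 1, ρ • Z t φ + (1 - ρ) • C t ∈ A) :
    ContinuousOn (fun q : ℝ × V3 => wrapMap (H q.1) (Z q.1) (C q.1) s q.2)
      (Set.Icc (0:ℝ) 1 ×ˢ sphereS) ∧
    ∀ t ∈ Set.Icc (0:ℝ) 1, Set.MapsTo (wrapMap (H t) (Z t) (C t) s) sphereS sphereS := by
  have hs' := w18_neg_sphere hs
  have hB1 : ∀ t ∈ Set.Icc (0:ℝ) 1, ∀ φ, H t (Z t φ) ∈ sphereS := fun t ht φ =>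
    hHs t ht _ (hBA (hZB t φ))
  have hB2 : ∀ t ∈ Set.Icc (0:ℝ) 1, ∀ φ, H t (Z t φ) ≠ - (-s) := fun t ht φ => by
    rw [neg_neg]; exact hHB t ht _ (hZB t φ)
  have up : ∀ q ∈ w18K, wrapMap (H (w18Q 1 q).1) (Z (w18Q 1 q).1) (C (w18Q 1 q).1) s (w18Q 1 q).2
      = H q.1 (q.2.1 • Z q.1 q.2.2 + (1 - q.2.1) • C q.1) := by
    rintro ⟨t, ρ, φ⟩ ⟨ht, hρ, hφ⟩
    simp only at ht hρ hφ
    simp only [w18Q]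
    rw [w18_pos _ _ _ _ _ (by simp [Real.sqrt_nonneg])]
    simp only [Matrix.cons_val_zero, Matrix.cons_val_one]
    rw [w18_sqrt ρ φ hρ.1]
    rcases hρ.1.eq_or_lt with h0 | h0
    · rw [← h0]; simp
    · rw [w18_arg ρ φ h0 hφ (Z t) (hZp t)]
  have lo : ∀ q ∈ w18K, wrapMap (H (w18Q (-1) q).1) (Z (w18Q (-1) q).1) (C (w18Q (-1) q).1) s
      (w18Q (-1) q).2 = geo (-s) (H q.1 (Z q.1 q.2.2)) q.2.1 := by
    rintro ⟨t, ρ, φ⟩ hq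
    have hq' := hq
    obtain ⟨ht, hρ, hφ⟩ := hq'
    simp only at ht hρ hφ
    rcases hρ.2.eq_or_lt with h1 | h1
    · have := up _ hq
      subst h1
      simp only [w18_geo_one hs' (hB1 t ht φ) (hB2 t ht φ)]
      simp only [w18Q] at this ⊢
      simp at this ⊢
      exact this
    · simp only [w18Q]
      have hpos : 0 < Real.sqrt (1 - ρ ^ 2) := Real.sqrt_pos.mpr (by nlinarith [hρ.1])
      rw [w18_neg _ _ _ _ _ (by
        simp only [Matrix.cons_val]; linarith)]
      simp only [Matrix.cons_val_zero, Matrix.cons_val_one]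
      rw [w18_sqrt ρ φ hρ.1]
      rcases hρ.1.eq_or_lt with h0 | h0
      · rw [← h0, w18_geo_zero hs' (hB1 t ht _) (hB2 t ht _),
          w18_geo_zero hs' (hB1 t ht _) (hB2 t ht _)]
      · rw [w18_arg ρ φ h0 hφ (Z t) (hZp t)]
  constructor
  · have c1 : ContinuousOn (fun q : ℝ × V3 => wrapMap (H q.1) (Z q.1) (C q.1) s q.2)
        (w18Q 1 '' w18K) := by
      apply w18_contOn_of_comp w18K_compact (w18Q_cont 1).continuousOn
      refine ContinuousOn.congr ?_ up
      have hm : Continuous (fun q : ℝ × ℝ × ℝ =>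
          (q.1, q.2.1 • Z q.1 q.2.2 + (1 - q.2.1) • C q.1)) := by
        have : Continuous fun q : ℝ × ℝ × ℝ => Z q.1 q.2.2 :=
          hZ.comp (by fun_prop : Continuous fun q : ℝ × ℝ × ℝ => (q.1, q.2.2))
        fun_prop
      exact hH.comp hm.continuousOn (fun q hq => ⟨hq.1, hseg _ _ _ hq.2.1⟩)
    have c2 : ContinuousOn (fun q : ℝ × V3 => wrapMap (H q.1) (Z q.1) (C q.1) s q.2)
        (w18Q (-1) '' w18K) := by
      apply w18_contOn_of_comp w18K_compact (w18Q_cont (-1)).continuousOn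
      refine ContinuousOn.congr ?_ lo
      have hm : ContinuousOn (fun q : ℝ × ℝ × ℝ => H q.1 (Z q.1 q.2.2)) w18K := by
        have : Continuous fun q : ℝ × ℝ × ℝ => (q.1, Z q.1 q.2.2) :=
          continuous_fst.prodMk
            (hZ.comp (by fun_prop : Continuous fun q : ℝ × ℝ × ℝ => (q.1, q.2.2)))
        exact hH.comp this.continuousOn (fun q hq => ⟨hq.1, hBA (hZB _ _)⟩)
      have hd : ContinuousOn (fun q : ℝ × ℝ × ℝ => Real.arccos ((-s) ⬝ᵥ H q.1 (Z q.1 q.2.2))) w18K := by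
        apply Real.continuous_arccos.comp_continuousOn
        have : Continuous (fun v : V3 => (-s) ⬝ᵥ v) := by
          simp only [dotProduct]; fun_prop
        exact this.comp_continuousOn hm
      have hρ : ContinuousOn (fun q : ℝ × ℝ × ℝ => q.2.1) w18K := by fun_prop
      refine ContinuousOn.congr (f := fun q : ℝ × ℝ × ℝ => _) ?_ (fun q hq => w18_geo_eq hs' (hB1 q.1 hq.1 _) (hB2 q.1 hq.1 _) _)
      have hne : ∀ q ∈ w18K, Real.sinc (Real.arccos ((-s) ⬝ᵥ H q.1 (Z q.1 q.2.2))) ≠ 0 :=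
        fun q hq => w18_sinc_ne hs' (hB1 q.1 hq.1 _) (hB2 q.1 hq.1 _)
      have hsc := Real.continuous_sinc
      refine ContinuousOn.add (ContinuousOn.smul (ContinuousOn.div ?_ ?_ hne) continuousOn_const)
        (ContinuousOn.smul (ContinuousOn.div ?_ ?_ hne) hm)
      · exact (continuousOn_const.sub hρ).mul
          (hsc.comp_continuousOn ((continuousOn_const.sub hρ).mul hd))
      · exact hsc.comp_continuousOn hd
      · exact hρ.mul (hsc.comp_continuousOn (hρ.mul hd))
      · exact hsc.comp_continuousOn hd
    refine (c1.union_of_isClosed c2 (w18K_compact.image (w18Q_cont _)).isClosed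
      (w18K_compact.image (w18Q_cont _)).isClosed).mono ?_
    rintro ⟨t, x⟩ ⟨ht, hx⟩
    rcases le_total 0 (x 2) with h | h
    · exact Or.inl (w18Q_surj t ht x hx 1 (Or.inl rfl) (by linarith))
    · exact Or.inr (w18Q_surj t ht x hx (-1) (Or.inr rfl) (by linarith))
  · intro t ht x hx
    rcases le_total 0 (x 2) with h | h
    · obtain ⟨q, hq, he⟩ := w18Q_surj t ht x hx 1 (Or.inl rfl) (by linarith)
      have := up q hq
      rw [he] at this
      simp only at this
      rw [this]
      exact hHs _ hq.1 _ (hseg _ _ _ hq.2.1)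
    · obtain ⟨q, hq, he⟩ := w18Q_surj t ht x hx (-1) (Or.inr rfl) (by linarith)
      have := lo q hq
      rw [he] at this
      simp only at this
      rw [this]
      exact w18_geo_sphere hs' (hB1 _ hq.1 _) (hB2 _ hq.1 _) _

lemma w18_frame {e₁ e₂ f₁ f₂ N : V3} (h11 : e₁ ⬝ᵥ e₁ = 1) (h22 : e₂ ⬝ᵥ e₂ = 1) (h12 : e₁ ⬝ᵥ e₂ = 0)
    (hN : crossProduct e₁ e₂ = N) (g11 : f₁ ⬝ᵥ f₁ = 1) (g22 : f₂ ⬝ᵥ f₂ = 1) (g12 : f₁ ⬝ᵥ f₂ = 0)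
    (gN : crossProduct f₁ f₂ = N) :
    ∃ δ : ℝ, ∀ β : ℝ, Real.cos β • f₁ + Real.sin β • f₂ =
      Real.cos (β + δ) • e₁ + Real.sin (β + δ) • e₂ := by
  have key : ∀ v a b : V3, crossProduct v (crossProduct a b) = (v ⬝ᵥ b) • a - (v ⬝ᵥ a) • b := by
    intro v a b
    ext i
    fin_cases i <;> simp [cross_apply, dotProduct, Fin.sum_univ_three] <;> ring
  have k1 := key f₁ e₁ e₂
  have k2 := key f₁ f₁ f₂
  have k3 := key f₂ e₁ e₂
  have k4 := key f₂ f₁ f₂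
  rw [hN] at k1 k3
  rw [gN] at k2 k4
  have g21 : f₂ ⬝ᵥ f₁ = 0 := by rw [dotProduct_comm]; exact g12
  have h21 : e₂ ⬝ᵥ e₁ = 0 := by rw [dotProduct_comm]; exact h12
  rw [k1, g12, g11, zero_smul, one_smul, zero_sub] at k2
  rw [k3, g22, g21, zero_smul, one_smul, sub_zero] at k4
  set x := f₁ ⬝ᵥ e₁
  set y := f₁ ⬝ᵥ e₂
  have hf2 : f₂ = x • e₂ - y • e₁ := by
    rw [← neg_neg f₂, ← k2]; abel
  have a1 : f₂ ⬝ᵥ e₂ = x := by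
    rw [hf2]; simp [sub_dotProduct, h22, h12]
  have a2 : f₂ ⬝ᵥ e₁ = -y := by
    rw [hf2]; simp [sub_dotProduct, h11, h21]
  have hf1 : f₁ = x • e₁ + y • e₂ := by
    rw [← k4, a1, a2, neg_smul, sub_neg_eq_add]
  have hxy : x * x + y * y = 1 := by
    rw [hf1] at g11
    simpa [h11, h22, h12, h21] using g11
  have hnorm : ‖(⟨x, y⟩ : ℂ)‖ = 1 := by
    have : ‖(⟨x, y⟩ : ℂ)‖ ^ 2 = 1 := by
      rw [← Complex.normSq_eq_norm_sq, Complex.normSq_apply]; exact hxy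
    nlinarith [norm_nonneg (⟨x, y⟩ : ℂ)]
  refine ⟨Complex.arg ⟨x, y⟩, fun β => ?_⟩
  have c := Complex.norm_mul_cos_arg ⟨x, y⟩
  have d := Complex.norm_mul_sin_arg ⟨x, y⟩
  rw [hnorm, one_mul] at c d
  simp only at c d
  rw [Real.cos_add, Real.sin_add, c, d, hf1, hf2]
  module

namespace PolyCtx

variable (P : PolyCtx)

lemma w18_chat_iff (a : Fin P.nv) (x : V3) :
    x ∈ P.Chat a ↔ (x - P.cpt a) ⬝ᵥ P.Cnormal a = 0 ∧ x ∈ P.Pbar := by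
  constructor
  · rintro ⟨h1, h2, -⟩
    exact ⟨h1, h2⟩
  · rintro ⟨h1, h2⟩
    refine ⟨h1, h2, ?_⟩
    rintro ⟨b, rfl⟩
    by_cases h : b = a
    · subst h
      exact (P.sep_vert b).ne' h1
    · exact (P.sep_other a b h).ne h1

lemma w18_chat_rall (a : Fin P.nv) {x : V3} (hx : x ∈ P.Chat a) : x ∈ P.Rall := by
  refine Set.mem_iInter.mpr fun b => ?_
  exact P.cleave_sub a b x hx.2.1 hx.1

lemma w18_chat_phat (a : Fin P.nv) {x : V3} (hx : x ∈ P.Chat a) : x ∈ P.PhatSet :=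
  ⟨hx.2, P.w18_chat_rall a hx⟩

lemma w18_bd_iff (a : Fin P.nv) (x : V3) :
    x ∈ P.bdChat a ↔ x ∈ P.Chat a ∧ ∃ c, x ⬝ᵥ P.Fnormal c = P.foffset c := by
  constructor
  · intro h
    obtain ⟨c, h1, h2, -⟩ := Set.mem_iUnion.mp h
    rw [P.face_def] at h2
    exact ⟨h1, c, h2.2⟩
  · rintro ⟨h1, c, h2⟩
    refine Set.mem_iUnion.mpr ⟨c, h1, ?_, P.w18_chat_rall a h1⟩
    rw [P.face_def]
    exact ⟨h1.2.1, h2⟩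

lemma w18_chat_comb (a : Fin P.nv) {x y : V3} (hx : x ∈ P.Chat a) (hy : y ∈ P.Chat a) {ρ : ℝ}
    (hρ : ρ ∈ Set.Icc (0:ℝ) 1) : ρ • x + (1 - ρ) • y ∈ P.Chat a := by
  rw [w18_chat_iff] at *
  refine ⟨?_, P.convex hx.2 hy.2 hρ.1 (by linarith [hρ.2]) (by ring)⟩
  have e : ρ • x + (1 - ρ) • y - P.cpt a = ρ • (x - P.cpt a) + (1 - ρ) • (y - P.cpt a) := by module
  rw [e, add_dotProduct, smul_dotProduct, smul_dotProduct, hx.1, hy.1]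
  simp

lemma w18_int_comb (a : Fin P.nv) {x y : V3} (hx : x ∈ P.Chat a) (hy : y ∈ P.Chat a)
    (hx' : x ∉ P.bdChat a) (hy' : y ∉ P.bdChat a) {ρ : ℝ}
    (hρ : ρ ∈ Set.Icc (0:ℝ) 1) : ρ • x + (1 - ρ) • y ∉ P.bdChat a := by
  rw [w18_bd_iff] at *
  rintro ⟨-, c, hc⟩
  have h1 : x ⬝ᵥ P.Fnormal c < P.foffset c :=
    lt_of_le_of_ne (P.face_supp c x hx.2.1) fun h => hx' ⟨hx, c, h⟩
  have h2 : y ⬝ᵥ P.Fnormal c < P.foffset c :=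
    lt_of_le_of_ne (P.face_supp c y hy.2.1) fun h => hy' ⟨hy, c, h⟩
  rw [add_dotProduct, smul_dotProduct, smul_dotProduct, smul_eq_mul, smul_eq_mul] at hc
  rcases hρ.1.eq_or_lt with h | h
  · rw [← h] at hc; linarith
  · nlinarith [hρ.2]

/-- `y` lies on the ray from `c` with direction `u`. -/
def w18Ray (c u y : V3) : Prop := y - c = ((y - c) ⬝ᵥ u) • u ∧ 0 ≤ (y - c) ⬝ᵥ u

lemma w18_ray_mk (c u : V3) (hu : u ⬝ᵥ u = 1) (r : ℝ) (hr : 0 ≤ r) : w18Ray c u (c + r • u) := by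
  have : (c + r • u - c) ⬝ᵥ u = r := by simp [hu]
  refine ⟨?_, ?_⟩
  · rw [this]; simp
  · rw [this]; exact hr

lemma w18_unique (a : Fin P.nv) {c u y y' : V3} (hc : c ∈ P.Chat a) (hc' : c ∉ P.bdChat a)
    (hy : y ∈ P.bdChat a) (hy' : y' ∈ P.bdChat a) (h : w18Ray c u y) (h' : w18Ray c u y') :
    y = y' := by
  have aux : ∀ (y y' : V3), y ∈ P.bdChat a → y' ∈ P.bdChat a → w18Ray c u y → w18Ray c u y' →
      ¬ (y - c) ⬝ᵥ u < (y' - c) ⬝ᵥ u := by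
    intro y y' hy hy' h h' hlt
    rw [w18_bd_iff] at hy hy' hc'
    obtain ⟨-, f, hf⟩ := hy
    have h1 : c ⬝ᵥ P.Fnormal f < P.foffset f :=
      lt_of_le_of_ne (P.face_supp f c hc.2.1) fun h => hc' ⟨hc, f, h⟩
    have h2 := P.face_supp f y' hy'.1.2.1
    have h3 := congrArg (fun v => v ⬝ᵥ P.Fnormal f) h.1
    have h4 := congrArg (fun v => v ⬝ᵥ P.Fnormal f) h'.1
    have h5 := h.2
    simp only [smul_dotProduct, smul_eq_mul] at h3 h4
    rw [sub_dotProduct _ _ (P.Fnormal f)] at h3 h4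
    generalize (y - c) ⬝ᵥ u = μ at *
    generalize (y' - c) ⬝ᵥ u = μ' at *
    have h6 : 0 < u ⬝ᵥ P.Fnormal f := by
      by_contra hn
      push Not at hn
      nlinarith
    nlinarith
  have e := le_antisymm (not_lt.mp (aux y' y hy' hy h' h)) (not_lt.mp (aux y y' hy hy' h h'))
  have h1 := h.1
  rw [e, ← h'.1] at h1
  exact sub_left_injective h1

lemma w18_hit (a : Fin P.nv) {c u : V3} (hc : c ∈ P.Chat a)
    (hu : u ⬝ᵥ u = 1) (huN : u ⬝ᵥ P.Cnormal a = 0) :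
    ∃ y ∈ P.bdChat a, w18Ray c u y := by
  have hcont : Continuous fun r : ℝ => c + r • u := by fun_prop
  have hconn : IsPreconnected ((fun r : ℝ => c + r • u) '' Set.Ici 0) :=
    isPreconnected_Ici.image _ hcont.continuousOn
  have hdot : Continuous fun x : V3 => x ⬝ᵥ u := by
    simp only [dotProduct]; fun_prop
  obtain ⟨M, hM⟩ := (P.compact.image hdot).bddAbove
  have hfr : ((fun r : ℝ => c + r • u) '' Set.Ici 0 ∩ frontier P.Pbar).Nonempty := by
    by_contra hne
    have hcov : ∀ x ∈ (fun r : ℝ => c + r • u) '' Set.Ici 0, x ∈ P.Pbar → x ∈ interior P.Pbar := by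
      intro x hx hxP
      by_contra hxi
      exact hne ⟨x, hx, subset_closure hxP, hxi⟩
    have hcr : c ∈ (fun r : ℝ => c + r • u) '' Set.Ici 0 := ⟨0, by simp, by simp⟩
    have hout : ((fun r : ℝ => c + r • u) '' Set.Ici 0 ∩ P.Pbarᶜ).Nonempty := by
      set r := max 0 (M - c ⬝ᵥ u + 1)
      refine ⟨c + r • u, ⟨r, Set.mem_Ici.mpr (le_max_left _ _), rfl⟩, fun hmem => ?_⟩
      have := hM ⟨_, hmem, rfl⟩
      simp only [add_dotProduct, smul_dotProduct, hu, smul_eq_mul, mul_one] at this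
      have := le_max_right 0 (M - c ⬝ᵥ u + 1)
      linarith
    obtain ⟨x, -, hx1, hx2⟩ := hconn (interior P.Pbar) P.Pbarᶜ isOpen_interior
      P.compact.isClosed.isOpen_compl
      (fun x hx => by
        by_cases h : x ∈ P.Pbar
        · exact Or.inl (hcov x hx h)
        · exact Or.inr h)
      ⟨c, hcr, hcov c hcr hc.2.1⟩ hout
    exact hx2 (interior_subset hx1)
  obtain ⟨_, ⟨r, hr, rfl⟩, hy⟩ := hfr
  refine ⟨c + r • u, ?_, w18_ray_mk c u hu r hr⟩
  rw [P.frontier_eq] at hy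
  obtain ⟨f, hf⟩ := Set.mem_iUnion.mp hy
  rw [P.face_def] at hf
  rw [w18_bd_iff, w18_chat_iff]
  refine ⟨⟨?_, hf.1⟩, f, hf.2⟩
  have : c + r • u - P.cpt a = (c - P.cpt a) + r • u := by abel
  rw [this, add_dotProduct, smul_dotProduct, huN, ((P.w18_chat_iff a c).mp hc).1]
  simp

end PolyCtx

/-- Wrapping numbers are homotopy invariants: homotopic fields in
`C⁰(P̂)` have the same wrapping number on every cleaved face. -/
theorem stmt_18 (P : PolyCtx) (deg : (V3 → V3) → ℤ) (hdeg : DegreeTheory deg)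
    (s : V3) (hs : P.AdmissibleS s) (n n' : V3 → V3)
    (hn : P.MemC0Phat n) (hn' : P.MemC0Phat n')
    (hhom : P.HomotopicPhat n n') (a : Fin P.nv) (w w' : ℤ)
    (hw : P.HasWrap deg s a n w) (hw' : P.HasWrap deg s a n' w') :
    w = w' := by
  obtain ⟨H, hHc, hHm, hH0, hH1⟩ := hhom
  obtain ⟨ctr, z, hctr, hctrb, ⟨hzc, hzp, e₁, e₂, h11, h22, h12, hN, θ, r, hθc, -, hθp, hr, hz⟩,
    hzr, rfl⟩ := hw
  obtain ⟨ctr', z', hctr', hctrb', ⟨hzc', hzp', f₁, f₂, g11, g22, g12, gN, θ', r', hθc', -, hθp',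
    hr', hz'⟩, hzr', rfl⟩ := hw'
  obtain ⟨δ, hδ⟩ := w18_frame h11 h22 h12 hN g11 g22 g12 gN
  have hcomp : IsCompact (P.bdChat a) := by
    rw [← hzr]
    exact Function.Periodic.compact_of_continuous hzp Real.two_pi_pos.ne' hzc
  have h21 : e₂ ⬝ᵥ e₁ = 0 := by rw [dotProduct_comm]; exact h12
  set u : ℝ → V3 := fun α => Real.cos α • e₁ + Real.sin α • e₂ with hu
  have huc : Continuous u := by fun_prop
  have hu1 : ∀ α, u α ⬝ᵥ u α = 1 := by
    intro α
    simp only [hu, add_dotProduct, dotProduct_add, smul_dotProduct, dotProduct_smul, smul_eq_mul,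
      h11, h22, h12, h21]
    have := Real.sin_sq_add_cos_sq α
    linear_combination this
  have huN : ∀ α, u α ⬝ᵥ P.Cnormal a = 0 := by
    intro α
    simp only [hu, ← hN, add_dotProduct, smul_dotProduct, dot_self_cross, dot_cross_self]
    simp
  have hup : ∀ α, u (α + 2 * Real.pi) = u α := by
    intro α
    simp [hu, Real.cos_add_two_pi, Real.sin_add_two_pi]
  set cl : ℝ → ℝ := fun t => max 0 (min 1 t) with hcl
  have hclc : Continuous cl := by fun_prop
  have hclm : ∀ t, cl t ∈ Set.Icc (0:ℝ) 1 := fun t =>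
    ⟨le_max_left _ _, max_le zero_le_one (min_le_left _ _)⟩
  set C : ℝ → V3 := fun t => cl t • ctr' + (1 - cl t) • ctr with hC
  have hCc : Continuous C := by fun_prop
  have hC0 : C 0 = ctr := by simp [hC, hcl]
  have hC1 : C 1 = ctr' := by simp [hC, hcl]
  have hCm : ∀ t, C t ∈ P.Chat a := fun t => P.w18_chat_comb a hctr' hctr (hclm t)
  have hCb : ∀ t, C t ∉ P.bdChat a := fun t => P.w18_int_comb a hctr' hctr hctrb' hctrb (hclm t)
  have hex : ∀ q : ℝ × ℝ, ∃ y ∈ P.bdChat a, PolyCtx.w18Ray (C q.1) (u q.2) y := fun q =>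
    P.w18_hit a (hCm q.1) (hu1 _) (huN _)
  choose R hRb hRr using hex
  have hRu : ∀ q y, y ∈ P.bdChat a → PolyCtx.w18Ray (C q.1) (u q.2) y → y = R q := fun q y hy h =>
    P.w18_unique a (hCm _) (hCb _) hy (hRb q) h (hRr q)
  have hdotc : Continuous fun q : V3 × V3 => q.1 ⬝ᵥ q.2 := by
    simp only [dotProduct]; fun_prop
  have hRc : Continuous R := by
    apply w18_cont_of_graph hcomp R
      {p : (ℝ × ℝ) × V3 | PolyCtx.w18Ray (C p.1.1) (u p.1.2) p.2} ?_ hRb hRr hRu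
    have d : Continuous fun p : (ℝ × ℝ) × V3 => (p.2 - C p.1.1) ⬝ᵥ u p.1.2 :=
      hdotc.comp (by fun_prop : Continuous fun p : (ℝ × ℝ) × V3 => (p.2 - C p.1.1, u p.1.2))
    exact (isClosed_eq (by fun_prop) (by fun_prop)).inter (isClosed_le continuous_const d)
  have hRp : ∀ t α, R (t, α + 2 * Real.pi) = R (t, α) := by
    intro t α
    apply hRu _ _ (hRb _)
    have := hRr (t, α + 2 * Real.pi)
    simp only [hup] at this
    exact this
  set Z : ℝ → ℝ → V3 := fun t φ => R (t, (1 - t) * θ φ + t * (θ' φ + δ)) with hZ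
  have hZc : Continuous fun q : ℝ × ℝ => Z q.1 q.2 := by
    apply hRc.comp; fun_prop
  have hZp : ∀ t φ, Z t (φ + 2 * Real.pi) = Z t φ := by
    intro t φ
    simp only [hZ, hθp, hθp']
    rw [← hRp t ((1 - t) * θ φ + t * (θ' φ + δ))]
    congr 2; ring
  have hZ0 : Z 0 = z := by
    funext φ
    symm
    apply hRu
    · rw [← hzr]; exact ⟨φ, rfl⟩
    · simp only [hC0, hz φ]
      have : (1 - 0) * θ φ + 0 * (θ' φ + δ) = θ φ := by ring
      rw [this]
      exact PolyCtx.w18_ray_mk _ _ (hu1 _) _ (hr φ).le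
  have hZ1 : Z 1 = z' := by
    funext φ
    symm
    apply hRu
    · rw [← hzr']; exact ⟨φ, rfl⟩
    · simp only [hC1, hz' φ]
      have : (1 - 1) * θ φ + 1 * (θ' φ + δ) = θ' φ + δ := by ring
      rw [this, hδ]
      exact PolyCtx.w18_ray_mk _ _ (hu1 _) _ (hr' φ).le
  have hbC : P.bdChat a ⊆ P.Chat a := fun x hx => ((P.w18_bd_iff a x).mp hx).1
  have hseg : ∀ t φ, ∀ ρ ∈ Set.Icc (0:ℝ) 1, ρ • Z t φ + (1 - ρ) • C t ∈ P.Chat a :=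
    fun t φ ρ hρ => P.w18_chat_comb a (hbC (hRb _)) (hCm t) hρ
  obtain ⟨W1, W2⟩ := w18_wrap s hs.1 P.PhatSet (P.bdChat a) H hHc
    (fun t ht x hx => (hHm t ht).2.1 x hx)
    (fun t ht x hx h => by
      obtain ⟨c, -, h2⟩ := Set.mem_iUnion.mp hx
      have := (hHm t ht).2.2 c x h2
      rw [h] at this
      exact hs.2 c this)
    (fun x hx => P.w18_chat_phat a (hbC hx)) Z hZc hZp (fun t φ => hRb _) C hCc
    (fun t φ ρ hρ => P.w18_chat_phat a (hseg t φ ρ hρ))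
  have h01 : (0:ℝ) ∈ Set.Icc (0:ℝ) 1 := by simp
  have h11' : (1:ℝ) ∈ Set.Icc (0:ℝ) 1 := by simp
  have agree : ∀ (m m' : V3 → V3) (t : ℝ), (∀ x ∈ P.PhatSet, m x = m' x) → ∀ x ∈ sphereS,
      wrapMap m (Z t) (C t) s x = wrapMap m' (Z t) (C t) s x := by
    intro m m' t hm x hx
    by_cases h : 0 ≤ x 2
    · rw [w18_pos _ _ _ _ _ h, w18_pos _ _ _ _ _ h]
      apply hm
      apply P.w18_chat_phat a
      apply hseg
      refine ⟨Real.sqrt_nonneg _, ?_⟩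
      apply Real.sqrt_le_iff.mpr ⟨zero_le_one, _⟩
      have hx' : x 0 * x 0 + x 1 * x 1 + x 2 * x 2 = 1 := by
        simpa [sphereS, dotProduct, Fin.sum_univ_three] using hx
      nlinarith [mul_self_nonneg (x 2)]
    · rw [w18_neg _ _ _ _ _ h, w18_neg _ _ _ _ _ h]
      rw [hm _ (P.w18_chat_phat a (hbC (hRb _)))]
  have A0 := agree _ _ 0 hH0
  have A1 := agree _ _ 1 hH1
  have cont : ∀ t ∈ Set.Icc (0:ℝ) 1, ContinuousOn (wrapMap (H t) (Z t) (C t) s) sphereS := by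
    intro t ht
    exact W1.comp (f := fun x : V3 => (t, x)) (by fun_prop) (fun x hx => ⟨ht, hx⟩)
  rw [hZ0, hC0] at A0
  rw [hZ1, hC1] at A1
  have c0 := cont 0 h01
  have c1 := cont 1 h11'
  have m0 := W2 0 h01
  have m1 := W2 1 h11'
  rw [hZ0, hC0] at c0 m0
  rw [hZ1, hC1] at c1 m1
  refine hdeg.1 _ _ (c0.congr fun x hx => (A0 x hx).symm) (m0.congr A0)
    (c1.congr fun x hx => (A1 x hx).symm) (m1.congr A1)
    ⟨fun t => wrapMap (H t) (Z t) (C t) s, W1, W2, ?_, ?_⟩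
  · intro x hx
    simp only [hZ0, hC0]
    exact A0 x hx
  · intro x hx
    simp only [hZ1, hC1]
    exact A1 x hx
end
end
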